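/- Let t be a real number with 0 < t < 1 and put q := exp( −2π · ₂F₁(1/2,1/2;1;1−t) / ₂F₁(1/2,1/2;1;t) ), so 0 < q < 1. Then −(π/8) · ( log((1−t)/16) + ((1−t)/4) · ₄F₃(3/2, 3/2, 1, 1; 2, 2, 2; 1−t) ) = D_q(i) + D_q(i·q^{1/2}), where i = √−1. -/

import Mathlib

set_option autoImplicit false

open scoped Real

/-- Pochhammer symbol `(a)_n = a(a+1)⋯(a+n−1)` for a real number. -/
noncomputable def pochR (a : ℝ) (n : ℕ) : ℝ := ∏ k ∈ Finset.range n, (a + k)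

/-- Gauss hypergeometric series `₂F₁(a,b;c;x)` (real). -/
noncomputable def hyp2F1 (a b c x : ℝ) : ℝ :=
  ∑' n : ℕ, (pochR a n * pochR b n) / (pochR c n * (n.factorial : ℝ)) * x ^ n

/-- Generalized hypergeometric series `₄F₃(a₁,a₂,a₃,a₄;b₁,b₂,b₃;x)` (real). -/
noncomputable def hyp4F3 (a₁ a₂ a₃ a₄ b₁ b₂ b₃ x : ℝ) : ℝ :=
  ∑' n : ℕ, (pochR a₁ n * pochR a₂ n * pochR a₃ n * pochR a₄ n) /
    (pochR b₁ n * pochR b₂ n * pochR b₃ n * (n.factorial : ℝ)) * x ^ n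

/-- The dilogarithm `Li₂(x) = Σ_{n≥1} xⁿ/n²` for `|x| ≤ 1`. -/
noncomputable def li2 (x : ℂ) : ℂ := ∑' n : ℕ, x ^ (n + 1) / ((n : ℂ) + 1) ^ 2

/-- The Bloch–Wigner function `D(x) = Im(Li₂(x)) + log|x|·arg(1−x)` for `|x| ≤ 1`,
extended to `|x| > 1` by `D(x) = −D(1/x)`. -/
noncomputable def blochWigner (x : ℂ) : ℝ :=
  if ‖x‖ ≤ 1 then (li2 x).im + Real.log ‖x‖ * Complex.arg (1 - x)
  else -((li2 x⁻¹).im + Real.log ‖x⁻¹‖ * Complex.arg (1 - x⁻¹))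

/-- The elliptic dilogarithm `D_q(x) = Σ_{n∈ℤ} D(x·qⁿ)` for `0 < q < 1`. -/
noncomputable def ellipticDilog (q : ℝ) (x : ℂ) : ℝ :=
  ∑' n : ℤ, blochWigner (x * (q : ℂ) ^ n)

section

open Filter Topology MeasureTheory

theorem Real.tendsto_tanh_atTop : Tendsto Real.tanh atTop (𝓝 1) := by
  have h : ∀ x, Real.tanh x = 1 - 2 * Real.exp (-(2 * x)) / (1 + Real.exp (-(2 * x))) := by
    intro x
    have e : Real.exp (-(2 * x)) = Real.exp (-x) * Real.exp (-x) := by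
      rw [← Real.exp_add]; ring_nf
    have e2 : Real.exp x * Real.exp (-x) = 1 := by rw [← Real.exp_add]; simp
    rw [Real.tanh_eq_sinh_div_cosh, Real.sinh_eq, Real.cosh_eq, e]
    have := Real.exp_pos x
    have := Real.exp_pos (-x)
    field_simp
    linear_combination (2 * Real.exp (-x)) * e2
  have h1 : Tendsto (fun x : ℝ => Real.exp (-(2 * x))) atTop (𝓝 0) :=
    Real.tendsto_exp_neg_atTop_nhds_zero.comp (tendsto_id.const_mul_atTop two_pos)
  simp_rw [funext h]
  have h2 := ((h1.const_mul 2).div (h1.const_add 1) (by norm_num)).const_sub 1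
  simpa using h2

theorem Real.tanh_sub_tanh (a b : ℝ) :
    Real.tanh a - Real.tanh b = Real.sinh (a - b) * (Real.cosh a)⁻¹ * (Real.cosh b)⁻¹ := by
  have ha := (Real.cosh_pos a).ne'
  have hb := (Real.cosh_pos b).ne'
  rw [Real.tanh_eq_sinh_div_cosh, Real.tanh_eq_sinh_div_cosh, Real.sinh_sub]
  field_simp

/-- Telescoping of `tanh` along an arithmetic progression, unit shift. -/
theorem hasSum_tanh_sub_one {w : ℝ} (hw : 0 < w) (α : ℝ) :
    HasSum (fun k : ℤ => Real.tanh ((k + α) * w) - Real.tanh ((k - 1 + α) * w)) 2 := by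
  have lim : ∀ β : ℝ, Tendsto (fun n : ℕ => Real.tanh ((n + β) * w)) atTop (𝓝 1) := fun β =>
    Real.tendsto_tanh_atTop.comp
      ((tendsto_atTop_add_const_right _ β tendsto_natCast_atTop_atTop).atTop_mul_const hw)
  have mono : ∀ x y : ℝ, x ≤ y → Real.tanh x ≤ Real.tanh y := by
    intro x y hxy
    have := Real.tanh_sub_tanh y x
    have h2 : 0 ≤ Real.sinh (y - x) := Real.sinh_nonneg_iff.2 (by linarith)
    have := Real.cosh_pos x
    have := Real.cosh_pos y
    have : 0 ≤ Real.sinh (y - x) * (Real.cosh y)⁻¹ * (Real.cosh x)⁻¹ := by positivity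
    linarith
  have key : ∀ β : ℝ, HasSum (fun n : ℕ => Real.tanh ((n + 1 + β) * w) - Real.tanh ((n + β) * w))
      (1 - Real.tanh (β * w)) := by
    intro β
    rw [hasSum_iff_tendsto_nat_of_nonneg]
    · have : ∀ n : ℕ, ∑ i ∈ Finset.range n,
          (Real.tanh ((i + 1 + β) * w) - Real.tanh ((i + β) * w))
          = Real.tanh ((n + β) * w) - Real.tanh (β * w) := by
        intro n
        have := Finset.sum_range_sub (fun i : ℕ => Real.tanh ((i + β) * w)) n
        simpa using this
      simp_rw [this]
      exact (lim β).sub_const _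
    · intro i
      exact sub_nonneg.2 (mono _ _ (by gcongr; linarith))
  have h1 := key (α - 1)
  have h2 := key (-α)
  have := HasSum.of_nat_of_neg_add_one
    (f := fun k : ℤ => Real.tanh ((k + α) * w) - Real.tanh ((k - 1 + α) * w))
    (m := 1 - Real.tanh ((α - 1) * w)) (m' := 1 - Real.tanh ((1 - α) * w)) ?_ ?_
  · convert this using 1
    have : Real.tanh ((1 - α) * w) = - Real.tanh ((α - 1) * w) := by
      rw [← Real.tanh_neg]; ring_nf
    rw [this]; ring
  · convert h1 using 2 with n
    push_cast
    ring_nf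
  · have h3 := key (1 - α)
    convert h3 using 2 with n
    rw [sub_eq_sub_iff_add_eq_add]
    have e1 : Real.tanh (((-((n : ℤ) + 1) : ℤ) + α) * w) = - Real.tanh ((n + (1 - α)) * w) := by
      rw [← Real.tanh_neg]; push_cast; ring_nf
    have e2 : Real.tanh (((-((n : ℤ) + 1) : ℤ) - 1 + α) * w)
        = - Real.tanh ((n + 1 + (1 - α)) * w) := by
      rw [← Real.tanh_neg]; push_cast; ring_nf
    rw [e1, e2]; ring

theorem hasSum_tanh_sub {w : ℝ} (hw : 0 < w) (α : ℝ) (j : ℤ) :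
    HasSum (fun k : ℤ => Real.tanh ((k + α) * w) - Real.tanh ((k - j + α) * w)) (2 * j) := by
  have base := hasSum_tanh_sub_one hw α
  have shift : ∀ (g : ℤ → ℝ) (s : ℝ) (i : ℤ), HasSum g s → HasSum (fun k => g (k + i)) s :=
    fun g s i h => (Equiv.addRight i).hasSum_iff.2 h
  induction j using Int.induction_on with
  | zero => simp
  | succ i ih =>
    convert base.add (shift _ _ (-1) ih) using 1
    · ext k; push_cast; ring_nf
    · push_cast; ring
  | pred i ih =>
    have h := ih.sub (shift _ _ (i + 1) base)
    have e : (2 : ℝ) * ((-(i : ℤ) - 1 : ℤ) : ℝ) = 2 * ((-(i : ℤ) : ℤ) : ℝ) - 2 := by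
      push_cast; ring
    rw [e]
    refine (congrArg (fun f => HasSum f _) ?_).mp h
    ext k
    push_cast
    ring_nf

theorem tsum_tanh_sub_of_antisymm {w : ℝ} (hw : 0 < w) {α : ℝ} {B : ℤ → ℝ} {c j : ℤ}
    (hα : 2 * α = j - c) (hB : ∀ k, B (c - k) = -B k)
    (hs : Summable fun k : ℤ => Real.tanh ((k + α) * w) - B k) :
    ∑' k : ℤ, (Real.tanh ((k + α) * w) - B k) = j := by
  have h1 := hs.hasSum
  have h2 := (Equiv.subLeft c).hasSum_iff.2 h1
  have h3 := (h1.add h2).unique (a₂ := 2 * (j : ℝ)) (by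
    convert hasSum_tanh_sub hw α j using 2 with k
    simp only [Function.comp_apply, Equiv.subLeft_apply, hB]
    have : Real.tanh (((c - k : ℤ) + α) * w) = - Real.tanh ((k - j + α) * w) := by
      rw [← Real.tanh_neg]
      congr 1
      push_cast
      linear_combination (w) * hα
    rw [this]; ring)
  linarith

/-- Exponential decay of a two-sided sequence. -/
def ExpDecay (f : ℤ → ℂ) : Prop :=
  ∃ C c : ℝ, 0 < c ∧ ∀ k, ‖f k‖ ≤ C * Real.exp (-c * |(k : ℝ)|)

theorem summable_exp_neg_mul_abs_int {c : ℝ} (hc : 0 < c) :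
    Summable fun k : ℤ => Real.exp (-c * |(k : ℝ)|) := by
  have h : Summable fun n : ℕ => Real.exp (-c * n) := by
    have := Real.summable_exp_nat_mul_iff.2 (neg_lt_zero.2 hc)
    simpa [mul_comm] using this
  apply Summable.of_nat_of_neg <;> simpa using h

theorem ExpDecay.summable_norm {f : ℤ → ℂ} (hf : ExpDecay f) : Summable fun k => ‖f k‖ := by
  obtain ⟨C, c, hc, h⟩ := hf
  exact Summable.of_nonneg_of_le (fun _ => norm_nonneg _) h
    ((summable_exp_neg_mul_abs_int hc).mul_left C)

theorem ExpDecay.mono {f g : ℤ → ℂ} (hf : ExpDecay f) (C' : ℝ) (hC : 0 ≤ C')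
    (h : ∀ k, ‖g k‖ ≤ C' * ‖f k‖) : ExpDecay g := by
  obtain ⟨C, c, hc, hb⟩ := hf
  refine ⟨C' * C, c, hc, fun k => (h k).trans ?_⟩
  rw [mul_assoc]
  exact mul_le_mul_of_nonneg_left (hb k) hC

theorem ExpDecay.mul_linear {f : ℤ → ℂ} (hf : ExpDecay f) (α : ℝ) :
    ExpDecay fun k => 2 * Complex.I * (k + α) * f k := by
  obtain ⟨C, c, hc, h⟩ := hf
  have hC : 0 ≤ C := by
    have := (norm_nonneg _).trans (h 0)
    simpa using this
  refine ⟨2 * (2 / c + |α|) * C, c / 2, by positivity, fun k => ?_⟩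
  rw [norm_mul, norm_mul, norm_mul]
  have e1 : ‖(k : ℂ) + α‖ ≤ |(k : ℝ)| + |α| := by
    refine (norm_add_le _ _).trans ?_
    simp
  have e2 : |(k : ℝ)| + |α| ≤ (2 / c + |α|) * Real.exp (c / 2 * |(k : ℝ)|) := by
    have h1 := Real.add_one_le_exp (c / 2 * |(k : ℝ)|)
    have h2 : 1 ≤ Real.exp (c / 2 * |(k : ℝ)|) := Real.one_le_exp (by positivity)
    have h3 : |α| * 1 ≤ |α| * Real.exp (c / 2 * |(k : ℝ)|) :=
      mul_le_mul_of_nonneg_left h2 (abs_nonneg _)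
    have h4 : |(k : ℝ)| ≤ 2 / c * Real.exp (c / 2 * |(k : ℝ)|) := by
      rw [div_mul_eq_mul_div, le_div_iff₀ hc]
      nlinarith
    linarith
  have e3 : Real.exp (-c * |(k : ℝ)|) * Real.exp (c / 2 * |(k : ℝ)|)
      = Real.exp (-(c / 2) * |(k : ℝ)|) := by
    rw [← Real.exp_add]; ring_nf
  calc ‖(2 : ℂ)‖ * ‖Complex.I‖ * ‖(k : ℂ) + α‖ * ‖f k‖
      = 2 * ‖(k : ℂ) + α‖ * ‖f k‖ := by simp
    _ ≤ 2 * ((2 / c + |α|) * Real.exp (c / 2 * |(k : ℝ)|)) * (C * Real.exp (-c * |(k : ℝ)|)) := by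
        gcongr
        · exact e1.trans e2
        · exact h k
    _ = _ := by rw [← e3]; ring

/-- Two-sided exponential series with frequencies `2 (k + α)`. -/
noncomputable def expSeries (α : ℝ) (f : ℤ → ℂ) (u : ℝ) : ℂ :=
  ∑' k : ℤ, f k * Complex.exp (2 * Complex.I * (k + α) * u)

theorem norm_mul_exp_freq (α : ℝ) (f : ℤ → ℂ) (u : ℝ) (k : ℤ) :
    ‖f k * Complex.exp (2 * Complex.I * (k + α) * u)‖ = ‖f k‖ := by
  have : 2 * Complex.I * ((k : ℂ) + α) * u = ((2 * (k + α) * u : ℝ) : ℂ) * Complex.I := by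
    push_cast; ring
  rw [norm_mul, this, Complex.norm_exp_ofReal_mul_I, mul_one]

theorem hasDerivAt_expSeries {f : ℤ → ℂ} (hf : ExpDecay f) (α u : ℝ) :
    HasDerivAt (expSeries α f) (expSeries α (fun k => 2 * Complex.I * (k + α) * f k) u) u := by
  have h1 := (hf.mul_linear α).summable_norm
  refine hasDerivAt_tsum h1
    (g := fun (k : ℤ) (v : ℝ) => f k * Complex.exp (2 * Complex.I * (k + α) * v))
    (g' := fun (k : ℤ) (v : ℝ) =>
      2 * Complex.I * (k + α) * f k * Complex.exp (2 * Complex.I * (k + α) * v))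
    (fun k v => ?_) (fun k v => ?_) (y₀ := 0) ?_ u
  · have h2 : HasDerivAt (fun v : ℝ => 2 * Complex.I * ((k : ℂ) + α) * v)
        (2 * Complex.I * (k + α) * 1) v := (Complex.ofRealCLM.hasDerivAt (x := v)).const_mul _
    refine ((h2.cexp).const_mul (f k)).congr_deriv ?_
    ring
  · rw [norm_mul_exp_freq α (fun k => 2 * Complex.I * (k + α) * f k)]
  · apply Summable.of_norm
    simp_rw [norm_mul_exp_freq]
    exact hf.summable_norm

theorem expSeries_mul {f g : ℤ → ℂ} (hf : ExpDecay f) (hg : ExpDecay g) (α β u : ℝ) :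
    expSeries α f u * expSeries β g u
      = expSeries (α + β) (fun n => ∑' k, f k * g (n - k)) u := by
  have h1 : Summable fun k => ‖f k * Complex.exp (2 * Complex.I * (k + α) * u)‖ := by
    simp_rw [norm_mul_exp_freq]; exact hf.summable_norm
  have h2 : Summable fun k => ‖g k * Complex.exp (2 * Complex.I * (k + β) * u)‖ := by
    simp_rw [norm_mul_exp_freq]; exact hg.summable_norm
  have hs := summable_mul_of_summable_norm h1 h2
  unfold expSeries
  rw [tsum_mul_tsum_of_summable_norm h1 h2]
  let e : ℤ × ℤ ≃ ℤ × ℤ :=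
    { toFun := fun p => (p.2, p.1 - p.2)
      invFun := fun p => (p.1 + p.2, p.1)
      left_inv := fun p => by simp
      right_inv := fun p => by simp }
  have he := e.summable_iff.2 hs
  rw [← e.tsum_eq]
  refine he.tsum_prod.trans ?_
  congr 1
  ext n
  rw [← tsum_mul_right]
  congr 1
  ext k
  simp only [e, Equiv.coe_fn_mk, Function.comp_apply]
  rw [mul_mul_mul_comm, ← Complex.exp_add]
  push_cast
  ring_nf

noncomputable def sechCoeff (α w : ℝ) (k : ℤ) : ℂ := (((Real.cosh ((k + α) * w))⁻¹ : ℝ) : ℂ)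

noncomputable def cschCoeff (w : ℝ) (k : ℤ) : ℂ :=
  -Complex.I * (((Real.sinh ((k + 1 / 2) * w))⁻¹ : ℝ) : ℂ)

theorem inv_cosh_le (x : ℝ) : (Real.cosh x)⁻¹ ≤ 2 * Real.exp (-|x|) := by
  rw [← Real.cosh_abs, Real.cosh_eq, inv_le_iff_one_le_mul₀ (by positivity)]
  have : Real.exp (-|x|) * Real.exp |x| = 1 := by rw [← Real.exp_add]; simp
  have h2 := Real.exp_pos (-|x|)
  nlinarith

theorem expDecay_sechCoeff (α : ℝ) {w : ℝ} (hw : 0 < w) : ExpDecay (sechCoeff α w) := by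
  refine ⟨2 * Real.exp (|α| * w), w, hw, fun k => ?_⟩
  have h0 := inv_cosh_le ((k + α) * w)
  have h1 := Real.cosh_pos ((k + α) * w)
  rw [sechCoeff, Complex.norm_real, Real.norm_of_nonneg (by positivity)]
  refine h0.trans ?_
  rw [mul_assoc, ← Real.exp_add]
  gcongr
  rw [abs_mul, abs_of_pos hw]
  have h2 : |(k : ℝ)| ≤ |(k : ℝ) + α| + |α| := by
    have := abs_sub ((k : ℝ) + α) α
    simpa using this
  nlinarith

theorem half_le_abs_int_add_half (k : ℤ) : (1 / 2 : ℝ) ≤ |(k : ℝ) + 1 / 2| := by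
  rcases le_or_gt 0 k with h | h
  · have : (0 : ℝ) ≤ k := by exact_mod_cast h
    exact le_trans (by linarith) (le_abs_self _)
  · have : (k : ℝ) ≤ -1 := by exact_mod_cast Int.le_sub_one_of_lt h
    exact le_trans (by linarith) (neg_le_abs _)

theorem int_add_half_ne_zero (k : ℤ) : (k : ℝ) + 1 / 2 ≠ 0 := by
  intro h
  have := half_le_abs_int_add_half k
  rw [h] at this
  norm_num at this

theorem sinh_int_add_half_ne_zero {w : ℝ} (hw : 0 < w) (k : ℤ) :
    Real.sinh ((k + 1 / 2) * w) ≠ 0 := by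
  rw [Ne, Real.sinh_eq_zero]
  exact mul_ne_zero (int_add_half_ne_zero k) hw.ne'

theorem expDecay_cschCoeff {w : ℝ} (hw : 0 < w) : ExpDecay (cschCoeff w) := by
  have hs : 0 < Real.sinh (w / 2) := Real.sinh_pos_iff.2 (by positivity)
  have hc := Real.cosh_pos (w / 2)
  refine (expDecay_sechCoeff (1 / 2) hw).mono (Real.cosh (w / 2) / Real.sinh (w / 2))
    (by positivity) fun k => ?_
  rw [cschCoeff, sechCoeff, norm_mul, norm_neg, Complex.norm_I, one_mul, Complex.norm_real,
    Complex.norm_real, norm_inv, norm_inv, Real.norm_eq_abs, Real.norm_eq_abs, Real.abs_sinh,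
    abs_of_pos (Real.cosh_pos _), ← Real.cosh_abs ((k + 1 / 2) * w)]
  have hx : w / 2 ≤ |((k : ℝ) + 1 / 2) * w| := by
    rw [abs_mul, abs_of_pos hw]
    nlinarith [half_le_abs_int_add_half k]
  set x := |((k : ℝ) + 1 / 2) * w|
  have hsx : 0 < Real.sinh x := Real.sinh_pos_iff.2 (by linarith)
  have hcx := Real.cosh_pos x
  have h2 : 0 ≤ Real.sinh (x - w / 2) := Real.sinh_nonneg_iff.2 (by linarith)
  rw [Real.sinh_sub] at h2
  rw [← div_eq_mul_inv, div_div, inv_le_iff_one_le_mul₀ hsx, ← mul_div_right_comm,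
    one_le_div (by positivity)]
  linarith

theorem ExpDecay.summable_conv {f g : ℤ → ℂ} (hf : ExpDecay f) (hg : ExpDecay g) (n : ℤ) :
    Summable fun k => f k * g (n - k) := by
  refine Summable.of_norm_bounded (g := fun k => ‖f k‖ * ∑' k, ‖g k‖)
    (hf.summable_norm.mul_right _) fun k => ?_
  rw [norm_mul]
  gcongr
  exact hg.summable_norm.le_tsum (n - k) fun _ _ => norm_nonneg _

theorem tsum_conv_of_antisymm {w : ℝ} (hw : 0 < w) {α : ℝ} {B : ℤ → ℝ} {c j : ℤ}
    (hα : 2 * α = j - c) (hB : ∀ k, B (c - k) = -B k) {F : ℤ → ℂ} {z : ℂ} (hz : z ≠ 0)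
    (hF : ∀ k, F k = z * ((Real.tanh ((k + α) * w) - B k : ℝ) : ℂ)) (hs : Summable F) :
    ∑' k, F k = z * j := by
  have h1 : Summable fun k : ℤ => Real.tanh ((k + α) * w) - B k := by
    rw [← Complex.summable_ofReal]
    refine (hs.mul_left z⁻¹).congr fun k => ?_
    rw [hF, inv_mul_cancel_left₀ hz]
  rw [tsum_congr hF, tsum_mul_left, ← Complex.ofReal_tsum,
    tsum_tanh_sub_of_antisymm hw hα hB h1]
  simp

theorem tsum_sech_mul_sech {w : ℝ} (hw : 0 < w) (n : ℤ) :
    ∑' k, sechCoeff 0 w k * sechCoeff (1 / 2) w (n - k)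
      = 2 * Complex.I * (n + (1 / 2 : ℝ)) * cschCoeff w n := by
  have hsn := sinh_int_add_half_ne_zero hw n
  rw [tsum_conv_of_antisymm hw (α := 0) (c := 2 * n + 1) (j := 2 * n + 1)
    (B := fun k => Real.tanh ((k - n - 1 / 2) * w))
    (z := (((Real.sinh ((n + 1 / 2) * w))⁻¹ : ℝ) : ℂ)) (by simp)
    (F := fun k => sechCoeff 0 w k * sechCoeff (1 / 2) w (n - k))]
  · rw [cschCoeff]
    push_cast
    linear_combination (2 * ((n : ℂ) + 1 / 2) * (Complex.sinh ((n + 1 / 2) * w))⁻¹)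
      * Complex.I_sq
  · intro k
    rw [← Real.tanh_neg]
    push_cast
    ring_nf
  · exact_mod_cast inv_ne_zero hsn
  · intro k
    rw [sechCoeff, sechCoeff, ← Complex.ofReal_mul, ← Complex.ofReal_mul, Real.tanh_sub_tanh]
    have e1 : ((k : ℝ) + 0) * w - (k - n - 1 / 2) * w = (n + 1 / 2) * w := by ring
    have e2 : Real.cosh (((n - k : ℤ) + 1 / 2) * w) = Real.cosh ((k - n - 1 / 2) * w) := by
      rw [← Real.cosh_neg]; push_cast; ring_nf
    rw [e1, e2]
    rw [mul_assoc, inv_mul_cancel_left₀ hsn]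
  · exact (expDecay_sechCoeff _ hw).summable_conv (expDecay_sechCoeff _ hw) n

theorem tsum_sech_mul_csch {w : ℝ} (hw : 0 < w) (n : ℤ) {α : ℝ} {a : ℤ} (ha : 2 * α = a) :
    ∑' k, sechCoeff α w k * cschCoeff w (n - k)
      = -(2 * Complex.I * (n + (1 / 2 : ℝ) + α) * sechCoeff (1 / 2 + α) w n) := by
  have hc := (Real.cosh_pos ((n + (1 / 2 + α)) * w)).ne'
  rw [tsum_conv_of_antisymm hw (α := α) (c := 2 * n + 1) (j := 2 * n + 1 + a)
    (B := fun k => -(Real.cosh ((n - k + 1 / 2) * w) / Real.sinh ((n - k + 1 / 2) * w)))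
    (z := -Complex.I * (((Real.cosh ((n + (1 / 2 + α)) * w))⁻¹ : ℝ) : ℂ))
    (by push_cast; linarith)
    (F := fun k => sechCoeff α w k * cschCoeff w (n - k))]
  · rw [sechCoeff]
    have ha' : (2 : ℂ) * α = a := by exact_mod_cast ha
    push_cast
    rw [← ha']
    ring
  · intro k
    have : ((n : ℝ) - (2 * n + 1 - k : ℤ) + 1 / 2) * w = -((n - k + 1 / 2) * w) := by
      push_cast; ring
    rw [this, Real.cosh_neg, Real.sinh_neg, div_neg]
  · refine mul_ne_zero (neg_ne_zero.2 Complex.I_ne_zero) ?_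
    exact_mod_cast inv_ne_zero hc
  · intro k
    rw [sechCoeff, cschCoeff, mul_left_comm, ← Complex.ofReal_mul, Real.tanh_eq_sinh_div_cosh]
    have hs := sinh_int_add_half_ne_zero hw (n - k)
    have hck := (Real.cosh_pos ((k + α) * w)).ne'
    rw [mul_assoc (-Complex.I), ← Complex.ofReal_mul]
    congr 2
    push_cast at hs ⊢
    have e : (n + (1 / 2 + α)) * w = (n - k + 1 / 2) * w + (k + α) * w := by ring
    rw [e, Real.cosh_add]
    rw [e, Real.cosh_add] at hc
    generalize ((n : ℝ) - k + 1 / 2) * w = y at *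
    generalize ((k : ℝ) + α) * w = x at *
    rw [eq_inv_mul_iff_mul_eq₀ hc]
    field_simp
    ring
  · exact (expDecay_sechCoeff _ hw).summable_conv (expDecay_cschCoeff hw) n

/-- The sum of `sech` over a shifted lattice. -/
noncomputable def sechSum (α w : ℝ) : ℝ := ∑' k : ℤ, (Real.cosh ((k + α) * w))⁻¹

theorem integral_cexp_div_two_cosh (η : ℝ) :
    ∫ x : ℝ, Complex.exp (η * x * Complex.I) * (((2 * Real.cosh (x / 2))⁻¹ : ℝ) : ℂ)
      = ((π / Real.cosh (π * η) : ℝ) : ℂ) := by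
  set a : ℂ := 1 / 2 + η * Complex.I with ha
  have hre : a.re = 1 / 2 := by simp [ha]
  have hre' : (1 - a).re = 1 / 2 := by rw [Complex.sub_re, hre]; norm_num
  have hbeta : Complex.betaIntegral a (1 - a) = ((π / Real.cosh (π * η) : ℝ) : ℂ) := by
    have h := Complex.Gamma_mul_Gamma_eq_betaIntegral (s := a) (t := 1 - a)
      (by rw [hre]; norm_num) (by rw [hre']; norm_num)
    rw [add_sub_cancel, Complex.Gamma_one, one_mul, Complex.Gamma_mul_Gamma_one_sub] at h
    rw [← h]
    have : (π : ℂ) * a = π * η * Complex.I + π / 2 := by rw [ha]; ring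
    rw [this, Complex.sin_add_pi_div_two]
    push_cast
    rw [← Complex.cos_mul_I]
  rw [← hbeta, Complex.betaIntegral, intervalIntegral.integral_of_le zero_le_one,
    integral_Ioc_eq_integral_Ioo, ← Real.range_sigmoid, ← Set.image_univ,
    integral_image_eq_integral_abs_deriv_smul MeasurableSet.univ
      (fun x _ => (Real.hasDerivAt_sigmoid x).hasDerivWithinAt)
      Real.sigmoid_injective.injOn, Measure.restrict_univ]
  congr 1
  ext x
  have hs := Real.sigmoid_pos x
  have hs1 := Real.sigmoid_lt_one x
  have h1s : (0 : ℝ) < 1 - Real.sigmoid x := by linarith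
  have hl : Real.log (Real.sigmoid x) = Real.log (1 - Real.sigmoid x) + x := by
    rw [← Real.sigmoid_neg, ← Real.sigmoid_mul_rexp_neg,
      Real.log_mul hs.ne' (Real.exp_pos _).ne', Real.log_exp]
    ring
  have hcosh : Real.exp (Real.log (1 - Real.sigmoid x) + x / 2) = (2 * Real.cosh (x / 2))⁻¹ := by
    rw [Real.exp_add, Real.exp_log h1s, ← Real.sigmoid_neg, Real.sigmoid_def, neg_neg,
      Real.cosh_eq]
    have : Real.exp x = Real.exp (x / 2) * Real.exp (x / 2) := by rw [← Real.exp_add]; ring_nf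
    have h2 : Real.exp (x / 2) * Real.exp (-(x / 2)) = 1 := by rw [← Real.exp_add]; simp
    rw [this]
    have := Real.exp_pos (x / 2)
    have := Real.exp_pos (-(x / 2))
    field_simp
    linear_combination h2
  rw [abs_of_pos (mul_pos hs h1s), Complex.real_smul, ← hcosh]
  have e1 : ((Real.sigmoid x : ℝ) : ℂ) = Complex.exp (Real.log (Real.sigmoid x)) := by
    rw [← Complex.ofReal_exp, Real.exp_log hs]
  have e2 : (1 : ℂ) - ((Real.sigmoid x : ℝ) : ℂ)
      = Complex.exp (Real.log (1 - Real.sigmoid x)) := by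
    rw [← Complex.ofReal_exp, Real.exp_log h1s]; push_cast; ring
  have n1 : ((Real.sigmoid x : ℝ) : ℂ) ≠ 0 := by exact_mod_cast hs.ne'
  have n2 : (1 : ℂ) - ((Real.sigmoid x : ℝ) : ℂ) ≠ 0 := by rw [e2]; exact Complex.exp_ne_zero _
  have l2 : Complex.log (1 - ((Real.sigmoid x : ℝ) : ℂ)) = Real.log (1 - Real.sigmoid x) := by
    rw [Complex.ofReal_log h1s.le]; push_cast; rfl
  rw [Complex.cpow_def_of_ne_zero n1, Complex.cpow_def_of_ne_zero n2, ← Complex.ofReal_log hs.le,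
    l2, Complex.ofReal_mul, Complex.ofReal_sub, Complex.ofReal_one, e2, e1, ← Complex.exp_add,
    ← Complex.exp_add, ← Complex.exp_add, Complex.ofReal_exp, ← Complex.exp_add, hl, ha]
  congr 1
  push_cast
  ring

/-- Fourier transform of a rescaled hyperbolic secant. -/
theorem fourier_sech {w : ℝ} (hw : 0 < w) (ξ : ℝ) :
    FourierTransform.fourier (fun x : ℝ => ((π / w * (Real.cosh (x * (π ^ 2 / w)))⁻¹ : ℝ) : ℂ)) ξ
      = (((Real.cosh (ξ * w))⁻¹ : ℝ) : ℂ) := by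
  have hπ := Real.pi_pos
  rw [Real.fourier_eq']
  have h := integral_cexp_div_two_cosh (-(ξ * w / π))
  have hsub := Measure.integral_comp_mul_right (fun y : ℝ =>
    Complex.exp ((-(ξ * w / π) : ℝ) * y * Complex.I) * (((2 * Real.cosh (y / 2))⁻¹ : ℝ) : ℂ))
    (2 * π ^ 2 / w)
  rw [h] at hsub
  have e : ∀ v : ℝ, Complex.exp (((-2 * π * inner ℝ v ξ : ℝ) : ℂ) * Complex.I) •
        ((π / w * (Real.cosh (v * (π ^ 2 / w)))⁻¹ : ℝ) : ℂ)
      = ((2 * π / w : ℝ) : ℂ) * (Complex.exp ((-(ξ * w / π) : ℝ) * (v * (2 * π ^ 2 / w) : ℝ)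
        * Complex.I) * (((2 * Real.cosh (v * (2 * π ^ 2 / w) / 2))⁻¹ : ℝ) : ℂ)) := by
    intro v
    have e1 : v * (2 * π ^ 2 / w) / 2 = v * (π ^ 2 / w) := by ring
    have e2 : -2 * π * inner ℝ v ξ = -(ξ * w / π) * (v * (2 * π ^ 2 / w)) := by
      simp only [RCLike.inner_apply, conj_trivial]
      field_simp
    have hr : π / w * (Real.cosh (v * (π ^ 2 / w)))⁻¹
        = 2 * π / w * (2 * Real.cosh (v * (π ^ 2 / w)))⁻¹ := by
      have := (Real.cosh_pos (v * (π ^ 2 / w))).ne'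
      generalize Real.cosh (v * (π ^ 2 / w)) = y at *
      field_simp
    rw [e1, e2, smul_eq_mul, hr, Complex.ofReal_mul (2 * π / w), Complex.ofReal_mul (-(ξ * w / π))]
    ring
  simp_rw [e]
  rw [integral_const_mul, hsub, Complex.real_smul, ← Complex.ofReal_mul, ← Complex.ofReal_mul]
  have e3 : π * -(ξ * w / π) = -(ξ * w) := by field_simp
  rw [e3, Real.cosh_neg, abs_of_pos (by positivity)]
  congr 1
  have := (Real.cosh_pos (ξ * w)).ne'
  generalize Real.cosh (ξ * w) = y at *
  field_simp

theorem expSeries_sech_eq {w : ℝ} (hw : 0 < w) (u : ℝ) :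
    expSeries 0 (sechCoeff 0 w) u = ((π / w * sechSum (u / π) (π ^ 2 / w) : ℝ) : ℂ) := by
  have hπ := Real.pi_pos
  set b := π ^ 2 / w with hb
  have hb0 : 0 < b := by positivity
  have key := Real.tsum_eq_tsum_fourier_of_rpow_decay_of_summable
    (f := fun x : ℝ => ((π / w * (Real.cosh (x * b))⁻¹ : ℝ) : ℂ)) (b := 2) ?_ one_lt_two ?_ ?_
    (u / π)
  · simp_rw [hb, fourier_sech hw, ← hb] at key
    rw [expSeries, sechSum, ← tsum_mul_left, Complex.ofReal_tsum]
    refine Eq.trans ?_ (key.symm.trans ?_)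
    · refine tsum_congr fun k => ?_
      rw [sechCoeff, add_zero, fourier_coe_apply]
      congr 2
      have : (π : ℂ) ≠ 0 := by exact_mod_cast hπ.ne'
      push_cast
      field_simp
      ring
    · exact tsum_congr fun k => by rw [add_comm]
  · refine Complex.continuous_ofReal.comp (continuous_const.mul (Continuous.inv₀ ?_ ?_))
    · exact Real.continuous_cosh.comp (continuous_id.mul continuous_const)
    · exact fun x => (Real.cosh_pos _).ne'
  · refine Asymptotics.IsBigO.of_bound (π / w * (4 / b ^ 2)) ?_
    filter_upwards [(isCompact_singleton (x := (0 : ℝ))).compl_mem_cocompact] with x hx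
    have hx0 : 0 < |x| := abs_pos.2 hx
    have h1 := inv_cosh_le (x * b)
    have h2 := Real.quadratic_le_exp_of_nonneg (abs_nonneg (x * b))
    have hc := Real.cosh_pos (x * b)
    rw [Complex.norm_real, Real.norm_of_nonneg (by positivity), Real.norm_of_nonneg (by positivity),
      mul_assoc]
    gcongr
    refine h1.trans ?_
    rw [Real.exp_neg, abs_mul, abs_of_pos hb0, Real.rpow_neg hx0.le, Real.rpow_two,
      ← div_eq_mul_inv, ← div_eq_mul_inv, div_div, div_le_div_iff₀ (Real.exp_pos _) (by positivity)]
    rw [abs_mul, abs_of_pos hb0] at h2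
    have : 0 < |x| * b := by positivity
    nlinarith
  · simp_rw [hb, fourier_sech hw]
    have := (expDecay_sechCoeff 0 hw).summable_norm.of_norm
    refine this.congr fun k => ?_
    simp [sechCoeff]

theorem expSeries_shift (α : ℝ) (f : ℤ → ℂ) (u : ℝ) :
    expSeries (α + 1) f u = expSeries α (fun k => f (k - 1)) u := by
  unfold expSeries
  rw [← (Equiv.subRight (1 : ℤ)).tsum_eq]
  refine tsum_congr fun k => ?_
  simp only [Equiv.subRight_apply]
  push_cast
  ring_nf

theorem ofReal_re_expSeries {α : ℝ} {f : ℤ → ℂ} {c : ℤ} (hc : (c : ℝ) = -2 * α)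
    (hf : ∀ k, (starRingEnd ℂ) (f (c - k)) = f k) (u : ℝ) :
    (((expSeries α f u).re : ℝ) : ℂ) = expSeries α f u := by
  rw [← Complex.conj_eq_iff_re, expSeries, Complex.conj_tsum, ← (Equiv.subLeft c).tsum_eq]
  refine tsum_congr fun k => ?_
  simp only [Equiv.subLeft_apply, map_mul, hf, ← Complex.exp_conj]
  congr 2
  have hc' : (c : ℂ) = -(2 * α) := by rw [← neg_mul]; exact_mod_cast hc
  simp only [map_mul, map_add, Complex.conj_ofReal, Complex.conj_I, Int.cast_sub, map_sub,
    map_intCast, map_ofNat, hc', map_neg]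
  ring

/-- Unnormalised Jacobi function `dn` with lattice parameter `w`. -/
noncomputable def jacobiDn (w u : ℝ) : ℝ := (expSeries 0 (sechCoeff 0 w) u).re

/-- Unnormalised Jacobi function `cn` with lattice parameter `w`. -/
noncomputable def jacobiCn (w u : ℝ) : ℝ := (expSeries (1 / 2) (sechCoeff (1 / 2) w) u).re

/-- Unnormalised Jacobi function `sn` with lattice parameter `w`. -/
noncomputable def jacobiSn (w u : ℝ) : ℝ := (expSeries (1 / 2) (cschCoeff w) u).re

theorem sechCoeff_reflect {α : ℝ} {c : ℤ} (hc : (c : ℝ) = -2 * α) (w : ℝ) (k : ℤ) :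
    sechCoeff α w (c - k) = sechCoeff α w k := by
  have e : ((c - k : ℤ) : ℝ) + α = -(k + α) := by push_cast; rw [hc]; ring
  rw [sechCoeff, sechCoeff, e, neg_mul, Real.cosh_neg]

theorem ofReal_jacobiDn (w u : ℝ) : (jacobiDn w u : ℂ) = expSeries 0 (sechCoeff 0 w) u := by
  refine ofReal_re_expSeries (c := 0) (by simp) (fun k => ?_) u
  rw [sechCoeff_reflect (by simp), sechCoeff, Complex.conj_ofReal]

theorem ofReal_jacobiCn (w u : ℝ) :
    (jacobiCn w u : ℂ) = expSeries (1 / 2) (sechCoeff (1 / 2) w) u := by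
  refine ofReal_re_expSeries (c := -1) (by norm_num) (fun k => ?_) u
  rw [sechCoeff_reflect (by norm_num), sechCoeff, Complex.conj_ofReal]

theorem ofReal_jacobiSn (w u : ℝ) :
    (jacobiSn w u : ℂ) = expSeries (1 / 2) (cschCoeff w) u := by
  refine ofReal_re_expSeries (c := -1) (by norm_num) (fun k => ?_) u
  have e : (((-1 - k : ℤ) : ℝ) + 1 / 2) * w = -((k + 1 / 2) * w) := by push_cast; ring
  rw [cschCoeff, cschCoeff, e, map_mul, Complex.conj_ofReal, map_neg, Complex.conj_I,
    Real.sinh_neg]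
  push_cast
  ring

theorem HasDerivAt.complex_re {f : ℝ → ℂ} {f' : ℂ} {u : ℝ} (h : HasDerivAt f f' u) :
    HasDerivAt (fun x => (f x).re) f'.re u :=
  Complex.reCLM.hasFDerivAt.comp_hasDerivAt u h

theorem hasDerivAt_jacobiSn {w : ℝ} (hw : 0 < w) (u : ℝ) :
    HasDerivAt (jacobiSn w) (jacobiCn w u * jacobiDn w u) u := by
  refine (hasDerivAt_expSeries (expDecay_cschCoeff hw) (1 / 2) u).complex_re.congr_deriv ?_
  rw [← Complex.ofReal_re (jacobiCn w u * jacobiDn w u)]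
  congr 1
  rw [mul_comm (jacobiCn w u), Complex.ofReal_mul, ofReal_jacobiDn, ofReal_jacobiCn,
    expSeries_mul (expDecay_sechCoeff _ hw) (expDecay_sechCoeff _ hw), zero_add]
  congr 1
  ext k
  rw [tsum_sech_mul_sech hw]

theorem hasDerivAt_jacobiCn {w : ℝ} (hw : 0 < w) (u : ℝ) :
    HasDerivAt (jacobiCn w) (-(jacobiDn w u * jacobiSn w u)) u := by
  refine (hasDerivAt_expSeries (expDecay_sechCoeff (1 / 2) hw) (1 / 2) u).complex_re.congr_deriv ?_
  rw [← Complex.ofReal_re (-(jacobiDn w u * jacobiSn w u))]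
  congr 1
  rw [Complex.ofReal_neg, Complex.ofReal_mul, ofReal_jacobiDn, ofReal_jacobiSn,
    expSeries_mul (expDecay_sechCoeff _ hw) (expDecay_cschCoeff hw), zero_add]
  unfold expSeries
  rw [← tsum_neg]
  refine tsum_congr fun k => ?_
  beta_reduce
  rw [tsum_sech_mul_csch hw k (a := 0) (by simp), add_zero]
  push_cast
  ring

theorem hasDerivAt_jacobiDn {w : ℝ} (hw : 0 < w) (u : ℝ) :
    HasDerivAt (jacobiDn w) (-(jacobiCn w u * jacobiSn w u)) u := by
  refine (hasDerivAt_expSeries (expDecay_sechCoeff 0 hw) 0 u).complex_re.congr_deriv ?_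
  rw [← Complex.ofReal_re (-(jacobiCn w u * jacobiSn w u))]
  congr 1
  rw [Complex.ofReal_neg, Complex.ofReal_mul, ofReal_jacobiCn, ofReal_jacobiSn,
    expSeries_mul (expDecay_sechCoeff _ hw) (expDecay_cschCoeff hw)]
  have : (1 / 2 + 1 / 2 : ℝ) = 0 + 1 := by norm_num
  rw [this, expSeries_shift]
  unfold expSeries
  rw [← tsum_neg]
  refine tsum_congr fun k => ?_
  beta_reduce
  rw [tsum_sech_mul_csch hw (k - 1) (a := 1) (by norm_num)]
  have e : sechCoeff (1 / 2 + 1 / 2) w (k - 1) = sechCoeff 0 w k := by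
    rw [sechCoeff, sechCoeff]
    push_cast
    ring_nf
  rw [e]
  push_cast
  ring

theorem summable_inv_cosh (α : ℝ) {w : ℝ} (hw : 0 < w) :
    Summable fun k : ℤ => (Real.cosh ((k + α) * w))⁻¹ := by
  have := (expDecay_sechCoeff α hw).summable_norm.of_norm
  exact Complex.summable_ofReal.1 this

theorem sechSum_pos (α : ℝ) {w : ℝ} (hw : 0 < w) : 0 < sechSum α w :=
  (summable_inv_cosh α hw).tsum_pos (fun _ => (inv_pos.2 (Real.cosh_pos _)).le) 0
    (inv_pos.2 (Real.cosh_pos _))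

theorem jacobiDn_eq_sechSum {w : ℝ} (hw : 0 < w) (u : ℝ) :
    jacobiDn w u = π / w * sechSum (u / π) (π ^ 2 / w) := by
  have := ofReal_jacobiDn w u
  rw [expSeries_sech_eq hw] at this
  exact_mod_cast this

theorem jacobiDn_pos {w : ℝ} (hw : 0 < w) (u : ℝ) : 0 < jacobiDn w u := by
  have hπ := Real.pi_pos
  rw [jacobiDn_eq_sechSum hw]
  exact mul_pos (by positivity) (sechSum_pos _ (by positivity))

theorem jacobiDn_zero (w : ℝ) : jacobiDn w 0 = sechSum 0 w := by
  rw [← Complex.ofReal_inj, ofReal_jacobiDn, expSeries, sechSum, Complex.ofReal_tsum]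
  simp [sechCoeff]

theorem jacobiCn_zero (w : ℝ) : jacobiCn w 0 = sechSum (1 / 2) w := by
  rw [← Complex.ofReal_inj, ofReal_jacobiCn, expSeries, sechSum, Complex.ofReal_tsum]
  simp [sechCoeff]

theorem jacobiSn_zero (w : ℝ) : jacobiSn w 0 = 0 := by
  rw [← Complex.ofReal_inj, ofReal_jacobiSn, expSeries]
  have h := (Equiv.subLeft (-1 : ℤ)).tsum_eq (cschCoeff w)
  have h2 : ∀ k : ℤ, cschCoeff w (Equiv.subLeft (-1 : ℤ) k) = -cschCoeff w k := by
    intro k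
    have e : (((-1 - k : ℤ) : ℝ) + 1 / 2) * w = -((k + 1 / 2) * w) := by push_cast; ring
    rw [Equiv.subLeft_apply, cschCoeff, cschCoeff, e, Real.sinh_neg]
    push_cast
    ring
  rw [tsum_congr h2, tsum_neg] at h
  simp only [Complex.ofReal_zero, mul_zero, Complex.exp_zero, mul_one]
  exact self_eq_neg.1 h.symm

theorem jacobiCn_pi_div_two (w : ℝ) : jacobiCn w (π / 2) = 0 := by
  rw [← Complex.ofReal_inj, ofReal_jacobiCn, expSeries]
  set g : ℤ → ℂ := fun k => sechCoeff (1 / 2) w k *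
    Complex.exp (2 * Complex.I * (k + (1 / 2 : ℝ)) * (π / 2 : ℝ)) with hg
  have h := (Equiv.subLeft (-1 : ℤ)).tsum_eq g
  have h2 : ∀ k : ℤ, g (Equiv.subLeft (-1 : ℤ) k) = -g k := by
    intro k
    simp only [Equiv.subLeft_apply, hg]
    rw [sechCoeff_reflect (by norm_num), ← mul_neg]
    congr 1
    have e1 : 2 * Complex.I * (((-1 - k : ℤ) : ℂ) + (1 / 2 : ℝ)) * (π / 2 : ℝ)
      = 2 * Complex.I * ((k : ℂ) + (1 / 2 : ℝ)) * (π / 2 : ℝ) + π * Complex.I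
        + ((-1 - k : ℤ) : ℂ) * (2 * π * Complex.I) := by
      push_cast; ring
    rw [e1, Complex.exp_add, Complex.exp_int_mul_two_pi_mul_I, Complex.exp_add,
      Complex.exp_pi_mul_I]
    ring
  rw [tsum_congr h2, tsum_neg] at h
  simp only [Complex.ofReal_zero]
  exact self_eq_neg.1 h.symm

theorem jacobiDn_sq_sub_sq {w : ℝ} (hw : 0 < w) (u : ℝ) :
    jacobiDn w u ^ 2 - jacobiCn w u ^ 2 = sechSum 0 w ^ 2 - sechSum (1 / 2) w ^ 2 := by
  have hd : ∀ x, HasDerivAt (fun u => jacobiDn w u ^ 2 - jacobiCn w u ^ 2) 0 x := fun x => by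
    refine (((hasDerivAt_jacobiDn hw x).pow 2).sub
      ((hasDerivAt_jacobiCn hw x).pow 2)).congr_deriv ?_
    push_cast
    ring
  have := is_const_of_deriv_eq_zero (fun x => (hd x).differentiableAt) (fun x => (hd x).deriv) u 0
  simpa only [jacobiDn_zero, jacobiCn_zero] using this

theorem sechSum_zero_eq {w : ℝ} (hw : 0 < w) : sechSum 0 w = π / w * sechSum 0 (π ^ 2 / w) := by
  rw [← jacobiDn_zero, jacobiDn_eq_sechSum hw, zero_div]

theorem sechSum_sq_sub_sq {w : ℝ} (hw : 0 < w) :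
    sechSum 0 w ^ 2 - sechSum (1 / 2) w ^ 2 = (π / w * sechSum (1 / 2) (π ^ 2 / w)) ^ 2 := by
  have h := jacobiDn_sq_sub_sq hw (π / 2)
  have e : π / 2 / π = 1 / 2 := by field_simp
  rw [jacobiCn_pi_div_two, jacobiDn_eq_sechSum hw, e] at h
  linarith

/-- The elliptic modular parameter `t = k²` attached to the lattice parameter `w`. -/
noncomputable def modParam (w : ℝ) : ℝ := (sechSum (1 / 2) w / sechSum 0 w) ^ 2

theorem modParam_pos {w : ℝ} (hw : 0 < w) : 0 < modParam w :=
  pow_pos (div_pos (sechSum_pos _ hw) (sechSum_pos _ hw)) 2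

theorem modParam_dual {w : ℝ} (hw : 0 < w) : modParam (π ^ 2 / w) = 1 - modParam w := by
  have hπ := Real.pi_pos
  have h1 := sechSum_pos 0 hw
  have h2 := sechSum_pos 0 (w := π ^ 2 / w) (by positivity)
  have h3 := sechSum_sq_sub_sq hw
  have h4 := sechSum_zero_eq hw
  have h5 : modParam (π ^ 2 / w)
      = (π / w * sechSum (1 / 2) (π ^ 2 / w)) ^ 2 / sechSum 0 w ^ 2 := by
    rw [modParam, h4]
    field_simp
  rw [h5, ← h3, modParam]
  field_simp

theorem modParam_lt_one {w : ℝ} (hw : 0 < w) : modParam w < 1 := by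
  have hπ := Real.pi_pos
  have := modParam_dual hw
  have := modParam_pos (w := π ^ 2 / w) (by positivity)
  linarith

theorem expDecay_sq_sechCoeff {w : ℝ} (hw : 0 < w) :
    ExpDecay fun k =>
      2 * Complex.I * (k + (0 : ℝ)) * (2 * Complex.I * (k + (0 : ℝ)) * sechCoeff 0 w k) :=
  ((expDecay_sechCoeff 0 hw).mul_linear 0).mul_linear 0

theorem hasSum_sq_div_cosh {w : ℝ} (hw : 0 < w) :
    HasSum (fun k : ℤ => (k : ℝ) ^ 2 / Real.cosh (k * w))
      (sechSum (1 / 2) w ^ 2 * sechSum 0 w / 4) := by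
  have hs : Summable fun k : ℤ => (k : ℝ) ^ 2 / Real.cosh (k * w) := by
    have := (expDecay_sq_sechCoeff hw).summable_norm.of_norm
    rw [← Complex.summable_ofReal]
    refine (this.mul_left (-1 / 4)).congr fun k => ?_
    rw [sechCoeff, add_zero]
    push_cast
    linear_combination (-(k : ℂ) ^ 2 / Complex.cosh (k * w)) * Complex.I_sq
  have h1 : HasDerivAt (fun u => (expSeries 0
      (fun k => 2 * Complex.I * (k + (0 : ℝ)) * sechCoeff 0 w k) u).re)
      (expSeries 0 (fun k => 2 * Complex.I * (k + (0 : ℝ)) *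
        (2 * Complex.I * (k + (0 : ℝ)) * sechCoeff 0 w k)) 0).re 0 :=
    (hasDerivAt_expSeries ((expDecay_sechCoeff 0 hw).mul_linear 0) 0 0).complex_re
  have h2 : (fun u => (expSeries 0
      (fun k => 2 * Complex.I * (k + (0 : ℝ)) * sechCoeff 0 w k) u).re)
      = fun u => -(jacobiCn w u * jacobiSn w u) := by
    ext u
    exact (hasDerivAt_expSeries (expDecay_sechCoeff 0 hw) 0 u).complex_re.unique
      (hasDerivAt_jacobiDn hw u)
  rw [h2] at h1
  have h3 := h1.unique ((hasDerivAt_jacobiCn hw 0).mul (hasDerivAt_jacobiSn hw 0)).neg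
  rw [jacobiSn_zero, jacobiCn_zero, jacobiDn_zero] at h3
  have h4 : expSeries 0 (fun k => 2 * Complex.I * (k + (0 : ℝ)) *
        (2 * Complex.I * (k + (0 : ℝ)) * sechCoeff 0 w k)) 0
      = ((-4 * ∑' k : ℤ, (k : ℝ) ^ 2 / Real.cosh (k * w) : ℝ) : ℂ) := by
    rw [← tsum_mul_left, Complex.ofReal_tsum, expSeries]
    refine tsum_congr fun k => ?_
    rw [sechCoeff, add_zero]
    simp only [Complex.ofReal_zero, mul_zero, Complex.exp_zero, mul_one]
    push_cast
    linear_combination (4 * (k : ℂ) ^ 2 / Complex.cosh (k * w)) * Complex.I_sq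
  rw [h4, Complex.ofReal_re] at h3
  convert hs.hasSum using 1
  linarith

/-- The coefficients `(1/2)_n / n!` of the binomial series of `(1 - x)^(-1/2)`. -/
noncomputable def wallisCoeff (n : ℕ) : ℝ :=
  ∏ i ∈ Finset.range n, (2 * (i : ℝ) + 1) / (2 * i + 2)

theorem wallisCoeff_zero : wallisCoeff 0 = 1 := by simp [wallisCoeff]

theorem wallisCoeff_succ (n : ℕ) :
    wallisCoeff (n + 1) = wallisCoeff n * ((2 * n + 1) / (2 * n + 2)) :=
  Finset.prod_range_succ _ _

theorem wallisCoeff_pos (n : ℕ) : 0 < wallisCoeff n :=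
  Finset.prod_pos fun i _ => by positivity

theorem wallisCoeff_le_one (n : ℕ) : wallisCoeff n ≤ 1 :=
  Finset.prod_le_one (fun i _ => by positivity) fun i _ => by
    rw [div_le_one (by positivity)]; linarith

theorem wallisCoeff_sq_le_one (n : ℕ) : wallisCoeff n ^ 2 ≤ 1 :=
  pow_le_one₀ (wallisCoeff_pos n).le (wallisCoeff_le_one n)

theorem abs_wallisCoeff_le_one (n : ℕ) : |wallisCoeff n| ≤ 1 := by
  rw [abs_of_pos (wallisCoeff_pos n)]; exact wallisCoeff_le_one n

theorem abs_wallisCoeff_sq_le_one (n : ℕ) : |wallisCoeff n ^ 2| ≤ 1 := by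
  rw [abs_of_pos (pow_pos (wallisCoeff_pos n) 2)]; exact wallisCoeff_sq_le_one n

theorem summable_mul_pow {c : ℕ → ℝ} (hc : ∀ n, |c n| ≤ 1) {x : ℝ} (hx : |x| < 1) :
    Summable fun n => c n * x ^ n := by
  refine Summable.of_norm_bounded (summable_geometric_of_lt_one (abs_nonneg x) hx) fun n => ?_
  rw [norm_mul, norm_pow, Real.norm_eq_abs, Real.norm_eq_abs]
  exact mul_le_of_le_one_left (by positivity) (hc n)

theorem summable_nat_mul_pow {c : ℕ → ℝ} (hc : ∀ n, |c n| ≤ 1) {x : ℝ} (hx : |x| < 1) :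
    Summable fun n : ℕ => (n : ℝ) * c n * x ^ n := by
  have := summable_pow_mul_geometric_of_norm_lt_one (R := ℝ) 1 (r := |x|) (by simpa using hx)
  refine Summable.of_norm_bounded this fun n => ?_
  rw [norm_mul, norm_mul, norm_pow, Real.norm_eq_abs, Real.norm_eq_abs, Real.norm_eq_abs,
    Nat.abs_cast, pow_one]
  exact mul_le_mul_of_nonneg_right (mul_le_of_le_one_right (by positivity) (hc n)) (by positivity)

theorem summable_succ_mul_pow {c : ℕ → ℝ} (hc : ∀ n, |c n| ≤ 1) {x : ℝ} (hx : |x| < 1) :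
    Summable fun n : ℕ => ((n : ℝ) + 1) * c (n + 1) * x ^ n := by
  have h1 := summable_nat_mul_pow (c := fun n => c (n + 1)) (fun n => hc _) hx
  have h2 := summable_mul_pow (c := fun n => c (n + 1)) (fun n => hc _) hx
  exact (h1.add h2).congr fun n => by ring

theorem hasDerivAt_tsum_mul_pow {c : ℕ → ℝ} (hc : ∀ n, |c n| ≤ 1) {x : ℝ} (hx : |x| < 1) :
    HasDerivAt (fun y => ∑' n, c n * y ^ n) (∑' n : ℕ, ((n : ℝ) + 1) * c (n + 1) * x ^ n) x := by
  obtain ⟨r, hr, hr1⟩ := exists_between hx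
  have hr0 : 0 ≤ r := (abs_nonneg x).trans hr.le
  have hu : Summable fun n : ℕ => (n : ℝ) * r ^ (n - 1) := by
    rw [← summable_nat_add_iff 1]
    have := summable_succ_mul_pow (c := fun _ => 1) (by simp) (x := r)
      (by rwa [abs_of_nonneg hr0])
    exact this.congr fun n => by simp
  have h := hasDerivAt_tsum_of_isPreconnected (𝕜 := ℝ) (F := ℝ)
    (g := fun (n : ℕ) y => c n * y ^ n)
    (g' := fun (n : ℕ) y => c n * (n * y ^ (n - 1))) hu (t := Metric.ball 0 r)
    Metric.isOpen_ball (convex_ball 0 r).isPreconnected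
    (fun n y _ => (hasDerivAt_pow n y).const_mul _) (fun n y hy => ?_)
    (y₀ := x) (y := x) (by simpa using hr) (summable_mul_pow hc hx) (by simpa using hr)
  · refine h.congr_deriv ?_
    rw [Summable.tsum_eq_zero_add]
    · simp only [Nat.cast_zero, zero_mul, mul_zero, zero_add]
      refine tsum_congr fun n => ?_
      rw [Nat.add_sub_cancel]
      push_cast
      ring
    · rw [← summable_nat_add_iff 1]
      refine (summable_succ_mul_pow hc hx).congr fun n => ?_
      rw [Nat.add_sub_cancel]
      push_cast
      ring
  · rw [mem_ball_zero_iff, Real.norm_eq_abs] at hy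
    rw [norm_mul, norm_mul, norm_pow, Real.norm_eq_abs, Real.norm_eq_abs, Real.norm_eq_abs,
      Nat.abs_cast]
    calc |c n| * (n * |y| ^ (n - 1)) ≤ 1 * (n * r ^ (n - 1)) := by
          gcongr
          exact hc n
      _ = _ := one_mul _

theorem tsum_wallisCoeff_mul_pow {x : ℝ} (h0 : 0 ≤ x) (h1 : x < 1) :
    ∑' n, wallisCoeff n * x ^ n = (Real.sqrt (1 - x))⁻¹ := by
  set P : ℝ → ℝ := fun y => ∑' n, wallisCoeff n * y ^ n with hP
  have hode : ∀ y : ℝ, |y| < 1 →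
      (1 - y) * ∑' n : ℕ, ((n : ℝ) + 1) * wallisCoeff (n + 1) * y ^ n = P y / 2 := by
    intro y hy
    have s1 := summable_succ_mul_pow abs_wallisCoeff_le_one hy
    have s2 := summable_nat_mul_pow abs_wallisCoeff_le_one hy
    have e : y * ∑' n : ℕ, ((n : ℝ) + 1) * wallisCoeff (n + 1) * y ^ n
        = ∑' n : ℕ, (n : ℝ) * wallisCoeff n * y ^ n := by
      rw [s2.tsum_eq_zero_add, ← tsum_mul_left]
      simp only [Nat.cast_zero, zero_mul, zero_add]
      refine tsum_congr fun n => ?_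
      push_cast
      ring
    rw [sub_mul, one_mul, e, ← s1.tsum_sub s2, hP, ← tsum_div_const]
    refine tsum_congr fun n => ?_
    rw [wallisCoeff_succ]
    field_simp
    ring
  have hx : |x| < 1 := by rwa [abs_of_nonneg h0]
  have hd : ∀ y ∈ Metric.ball (0 : ℝ) 1, HasDerivWithinAt (fun z => P z ^ 2 * (1 - z)) 0
      (Metric.ball 0 1) y := by
    intro y hy
    rw [mem_ball_zero_iff, Real.norm_eq_abs] at hy
    have h2 := ((hasDerivAt_tsum_mul_pow abs_wallisCoeff_le_one hy).pow 2).mul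
      ((hasDerivAt_id y).const_sub 1)
    refine (h2.congr_deriv ?_).hasDerivWithinAt
    have := hode y hy
    change (2 : ℕ) * P y ^ (2 - 1) * _ * (1 - y) + P y ^ 2 * -1 = 0
    rw [Nat.cast_two, show 2 - 1 = 1 from rfl, pow_one]
    linear_combination (2 * P y) * this
  have hconst := (convex_ball (0 : ℝ) 1).is_const_of_fderivWithin_eq_zero (𝕜 := ℝ)
    (f := fun z => P z ^ 2 * (1 - z)) (fun y hy => (hd y hy).differentiableWithinAt)
    (fun y hy => by
      have := (hd y hy).hasFDerivWithinAt.fderivWithin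
        (Metric.isOpen_ball.uniqueDiffWithinAt hy)
      rw [this]; ext; simp)
    (x := x) (y := 0) (by simpa using hx) (by simp)
  have hP0 : P 0 = 1 := by
    rw [hP]
    beta_reduce
    rw [tsum_eq_single 0 (fun n hn => by simp [hn])]
    simp [wallisCoeff_zero]
  have hPpos : 0 ≤ P x := tsum_nonneg fun n => mul_nonneg (wallisCoeff_pos n).le (by positivity)
  simp only [hP0, one_pow, sub_zero, mul_one] at hconst
  have h3 : 0 < 1 - x := by linarith
  have hs := Real.sqrt_pos.2 h3
  have hs2 := Real.sq_sqrt h3.le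
  rw [← hs2, ← mul_pow] at hconst
  have h4 := (pow_eq_one_iff_of_nonneg (by positivity) two_ne_zero).1 hconst
  exact eq_inv_of_mul_eq_one_left h4

/-- The power series `∑ ((1/2)_n / n!)² xⁿ`. -/
noncomputable def ellF (x : ℝ) : ℝ := ∑' n : ℕ, wallisCoeff n ^ 2 * x ^ n

theorem pochR_one (n : ℕ) : pochR 1 n = n.factorial := by
  rw [pochR, ← Finset.prod_range_add_one_eq_factorial]
  push_cast
  exact Finset.prod_congr rfl fun i _ => add_comm _ _

theorem pochR_half (n : ℕ) : pochR (1 / 2) n = wallisCoeff n * n.factorial := by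
  induction n with
  | zero => simp [pochR, wallisCoeff]
  | succ n ih =>
    rw [pochR, Finset.prod_range_succ, ← pochR, ih, wallisCoeff_succ, Nat.factorial_succ]
    push_cast
    field_simp
    ring

theorem hyp2F1_half (x : ℝ) : hyp2F1 (1 / 2) (1 / 2) 1 x = ellF x := by
  refine tsum_congr fun n => ?_
  have : (n.factorial : ℝ) ≠ 0 := by exact_mod_cast n.factorial_ne_zero
  rw [pochR_one, pochR_half]
  field_simp

theorem integral_inv_sqrt_one_sub_mul_sin_sq {t : ℝ} (h0 : 0 ≤ t) (h1 : t < 1) :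
    ∫ θ in (0 : ℝ)..π, (Real.sqrt (1 - t * Real.sin θ ^ 2))⁻¹ = π * ellF t := by
  have h := intervalIntegral.hasSum_integral_of_dominated_convergence (a := 0) (b := π)
    (μ := volume) (F := fun (n : ℕ) θ => wallisCoeff n * (t * Real.sin θ ^ 2) ^ n)
    (f := fun θ => (Real.sqrt (1 - t * Real.sin θ ^ 2))⁻¹) (fun n _ => t ^ n)
    (fun n => (by fun_prop : Continuous fun θ =>
      wallisCoeff n * (t * Real.sin θ ^ 2) ^ n).aestronglyMeasurable)
    (fun n => ae_of_all _ fun θ _ => ?_)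
    (ae_of_all _ fun θ _ => summable_geometric_of_lt_one h0 h1) (by simp)
    (ae_of_all _ fun θ _ => ?_)
  · rw [← h.tsum_eq, ellF, ← tsum_mul_left]
    refine tsum_congr fun n => ?_
    simp_rw [mul_pow, ← pow_mul]
    rw [intervalIntegral.integral_const_mul, intervalIntegral.integral_const_mul,
      integral_sin_pow_even, ← wallisCoeff]
    ring
  · rw [norm_mul, norm_pow, Real.norm_eq_abs, abs_of_pos (wallisCoeff_pos n), Real.norm_eq_abs,
      abs_of_nonneg (by positivity)]
    calc wallisCoeff n * (t * Real.sin θ ^ 2) ^ n ≤ 1 * (t * 1) ^ n := by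
          gcongr
          · exact wallisCoeff_le_one n
          · exact Real.sin_sq_le_one θ
      _ = t ^ n := by simp
  · have e0 : 0 ≤ t * Real.sin θ ^ 2 := by positivity
    have e1 : t * Real.sin θ ^ 2 < 1 :=
      (mul_le_of_le_one_right h0 (Real.sin_sq_le_one θ)).trans_lt h1
    rw [← tsum_wallisCoeff_mul_pow e0 e1]
    exact (summable_mul_pow abs_wallisCoeff_le_one (by rwa [abs_of_nonneg e0])).hasSum

theorem exists_jacobi_amplitude {w : ℝ} (hw : 0 < w) :
    ∃ φ : ℝ → ℝ, (∀ u, HasDerivAt φ (jacobiDn w u) u) ∧ φ 0 = 0 ∧ φ π = π := by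
  set g : ℤ → ℂ := fun k => sechCoeff 0 w k / (2 * Complex.I * (k + (0 : ℝ))) with hg
  have hgd : ExpDecay g := by
    refine (expDecay_sechCoeff 0 hw).mono 1 zero_le_one fun k => ?_
    rw [one_mul, hg]
    beta_reduce
    rw [norm_div]
    rcases eq_or_ne k 0 with rfl | hk
    · simp
    · refine div_le_self (norm_nonneg _) ?_
      have : (1 : ℝ) ≤ |(k : ℝ)| := by exact_mod_cast Int.one_le_abs hk
      simp
      linarith
  have hder : ∀ u, expSeries 0 (fun k => 2 * Complex.I * (k + (0 : ℝ)) * g k) u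
      = jacobiDn w u - 1 := by
    intro u
    have hs : Summable fun k : ℤ =>
        sechCoeff 0 w k * Complex.exp (2 * Complex.I * (k + (0 : ℝ)) * u) := by
      apply Summable.of_norm
      simp_rw [norm_mul_exp_freq]
      exact (expDecay_sechCoeff 0 hw).summable_norm
    have hs' : Summable fun k : ℤ => 2 * Complex.I * (k + (0 : ℝ)) * g k *
        Complex.exp (2 * Complex.I * (k + (0 : ℝ)) * u) := by
      apply Summable.of_norm
      simp_rw [norm_mul_exp_freq 0 (fun k => 2 * Complex.I * (k + (0 : ℝ)) * g k)]
      exact (hgd.mul_linear 0).summable_norm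
    rw [ofReal_jacobiDn, expSeries, expSeries, eq_sub_iff_add_eq, ← eq_sub_iff_add_eq',
      ← hs.tsum_sub hs', tsum_eq_single 0]
    · simp [sechCoeff]
    · intro k hk
      have : 2 * Complex.I * ((k : ℂ) + (0 : ℝ)) ≠ 0 := by simpa using hk
      rw [hg]
      beta_reduce
      rw [mul_div_cancel₀ _ this, sub_self]
  refine ⟨fun u => u + ((expSeries 0 g u).re - (expSeries 0 g 0).re), fun u => ?_, by simp, ?_⟩
  · have h1 := (hasDerivAt_expSeries hgd 0 u).complex_re
    rw [hder] at h1
    refine ((hasDerivAt_id u).add (h1.sub_const _)).congr_deriv ?_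
    simp
  · have : expSeries 0 g π = expSeries 0 g 0 := by
      refine tsum_congr fun k => ?_
      have e : 2 * Complex.I * ((k : ℂ) + (0 : ℝ)) * (π : ℝ) = k * (2 * π * Complex.I) := by
        push_cast; ring
      rw [e, Complex.exp_int_mul_two_pi_mul_I]
      simp
    beta_reduce
    rw [this, sub_self, add_zero]

theorem ellF_modParam {w : ℝ} (hw : 0 < w) : ellF (modParam w) = sechSum 0 w := by
  obtain ⟨φ, hφ, hφ0, hφπ⟩ := exists_jacobi_amplitude hw
  have hM := sechSum_pos 0 hw
  have hX : ∀ u, jacobiCn w u * Real.cos (φ u) + jacobiSn w u * Real.sin (φ u)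
      = sechSum (1 / 2) w := by
    intro u
    have hd : ∀ x, HasDerivAt (fun u => jacobiCn w u * Real.cos (φ u)
        + jacobiSn w u * Real.sin (φ u)) 0 x := fun x => by
      refine (((hasDerivAt_jacobiCn hw x).mul (hφ x).cos).add
        ((hasDerivAt_jacobiSn hw x).mul (hφ x).sin)).congr_deriv ?_
      ring
    have := is_const_of_deriv_eq_zero (fun x => (hd x).differentiableAt)
      (fun x => (hd x).deriv) u 0
    simpa [hφ0, jacobiCn_zero] using this
  have hY : ∀ u, jacobiCn w u * Real.sin (φ u) - jacobiSn w u * Real.cos (φ u) = 0 := by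
    intro u
    have hd : ∀ x, HasDerivAt (fun u => jacobiCn w u * Real.sin (φ u)
        - jacobiSn w u * Real.cos (φ u)) 0 x := fun x => by
      refine (((hasDerivAt_jacobiCn hw x).mul (hφ x).sin).sub
        ((hasDerivAt_jacobiSn hw x).mul (hφ x).cos)).congr_deriv ?_
      ring
    have := is_const_of_deriv_eq_zero (fun x => (hd x).differentiableAt)
      (fun x => (hd x).deriv) u 0
    simpa [hφ0, jacobiSn_zero] using this
  have hdn : ∀ u, jacobiDn w u
      = sechSum 0 w * Real.sqrt (1 - modParam w * Real.sin (φ u) ^ 2) := by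
    intro u
    have hc : jacobiCn w u = sechSum (1 / 2) w * Real.cos (φ u) := by
      linear_combination Real.cos (φ u) * hX u + Real.sin (φ u) * hY u
        - jacobiCn w u * Real.sin_sq_add_cos_sq (φ u)
    have h1 := jacobiDn_sq_sub_sq hw u
    have h2 : jacobiDn w u ^ 2
        = sechSum 0 w ^ 2 * (1 - modParam w * Real.sin (φ u) ^ 2) := by
      rw [hc] at h1
      have : sechSum 0 w ^ 2 * modParam w = sechSum (1 / 2) w ^ 2 := by
        rw [modParam]; field_simp
      linear_combination h1 + Real.sin (φ u) ^ 2 * this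
        + sechSum (1 / 2) w ^ 2 * Real.sin_sq_add_cos_sq (φ u)
    rw [← Real.sqrt_sq (jacobiDn_pos hw u).le, h2, Real.sqrt_mul (by positivity),
      Real.sqrt_sq hM.le]
  have hpos : ∀ θ, 0 < 1 - modParam w * Real.sin θ ^ 2 := fun θ => by
    have h1 := Real.sin_sq_le_one θ
    have h2 := modParam_pos hw
    have h3 := modParam_lt_one hw
    nlinarith
  have hcont : Continuous fun θ => (Real.sqrt (1 - modParam w * Real.sin θ ^ 2))⁻¹ :=
    Continuous.inv₀ (by fun_prop) fun θ => (Real.sqrt_pos.2 (hpos θ)).ne'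
  have hdc : Continuous (jacobiDn w) :=
    continuous_iff_continuousAt.2 fun u => (hasDerivAt_jacobiDn hw u).continuousAt
  have hsub := intervalIntegral.integral_comp_mul_deriv (a := 0) (b := π)
    (fun u _ => hφ u) hdc.continuousOn hcont
  rw [hφ0, hφπ, integral_inv_sqrt_one_sub_mul_sin_sq (modParam_pos hw).le
    (modParam_lt_one hw)] at hsub
  have h1 : ∀ u, ((fun θ => (Real.sqrt (1 - modParam w * Real.sin θ ^ 2))⁻¹) ∘ φ) u
      * jacobiDn w u = sechSum 0 w := by
    intro u
    have := (Real.sqrt_pos.2 (hpos (φ u))).ne'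
    rw [hdn, Function.comp_apply]
    field_simp
  simp_rw [h1] at hsub
  rw [intervalIntegral.integral_const, smul_eq_mul, sub_zero] at hsub
  exact (mul_left_cancel₀ Real.pi_ne_zero hsub).symm

theorem ellF_one_sub_modParam {w : ℝ} (hw : 0 < w) :
    ellF (1 - modParam w) = w / π * sechSum 0 w := by
  have hπ := Real.pi_pos
  rw [← modParam_dual hw, ellF_modParam (by positivity), sechSum_zero_eq hw]
  field_simp

theorem tendsto_sechSum_zero : Tendsto (sechSum 0) atTop (𝓝 1) := by
  have h := tendsto_tsum_of_dominated_convergence (𝓕 := (atTop : Filter ℝ))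
    (f := fun (w : ℝ) (k : ℤ) => (Real.cosh ((k + 0) * w))⁻¹) (g := fun k => if k = 0 then 1 else 0)
    (bound := fun k : ℤ => 2 * Real.exp (-1 * |(k : ℝ)|))
    ((summable_exp_neg_mul_abs_int one_pos).mul_left 2) (fun k => ?_) ?_
  · rwa [tsum_ite_eq] at h
  · split_ifs with hk
    · simp [hk]
    · have hk' : 0 < |(k : ℝ)| := abs_pos.2 (by exact_mod_cast hk)
      refine squeeze_zero (fun w => (inv_pos.2 (Real.cosh_pos _)).le)
        (fun w => inv_cosh_le _) ?_
      have : Tendsto (fun w : ℝ => Real.exp (-|((k : ℝ) + 0) * w|)) atTop (𝓝 0) := by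
        refine Real.tendsto_exp_neg_atTop_nhds_zero.comp ?_
        simp_rw [abs_mul, add_zero]
        exact tendsto_abs_atTop_atTop.const_mul_atTop hk'
      simpa using this.const_mul 2
  · filter_upwards [eventually_ge_atTop 1] with w hw k
    rw [Real.norm_of_nonneg (inv_pos.2 (Real.cosh_pos _)).le]
    refine (inv_cosh_le _).trans ?_
    gcongr
    rw [add_zero, abs_mul, neg_one_mul, neg_le_neg_iff]
    exact le_mul_of_one_le_right (abs_nonneg _) (hw.trans (le_abs_self w))

theorem tendsto_exp_mul_sechSum_half :
    Tendsto (fun w => Real.exp (w / 2) * sechSum (1 / 2) w) atTop (𝓝 4) := by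
  have hb : ∀ (w : ℝ) (k : ℤ), 0 ≤ w → Real.exp (w / 2) * (Real.cosh ((k + 1 / 2) * w))⁻¹
      ≤ 2 * Real.exp (-((|(k : ℝ) + 1 / 2| - 1 / 2) * w)) := by
    intro w k hw
    calc _ ≤ Real.exp (w / 2) * (2 * Real.exp (-|((k : ℝ) + 1 / 2) * w|)) := by
          gcongr; exact inv_cosh_le _
      _ = _ := by
          rw [mul_left_comm, ← Real.exp_add, abs_mul, abs_of_nonneg hw]
          ring_nf
  have h := tendsto_tsum_of_dominated_convergence (𝓕 := (atTop : Filter ℝ))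
    (f := fun (w : ℝ) (k : ℤ) => Real.exp (w / 2) * (Real.cosh ((k + 1 / 2) * w))⁻¹)
    (g := fun k => if k ∈ ({0, -1} : Finset ℤ) then 2 else 0)
    (bound := fun k : ℤ => 2 * Real.exp 1 * Real.exp (-1 * |(k : ℝ)|))
    ((summable_exp_neg_mul_abs_int one_pos).mul_left _) (fun k => ?_) ?_
  · simp_rw [tsum_mul_left] at h
    rw [tsum_eq_sum (s := {0, -1}) fun b hb => if_neg hb] at h
    have e : ∑ k ∈ ({0, -1} : Finset ℤ), (if k ∈ ({0, -1} : Finset ℤ) then (2 : ℝ) else 0) = 4 := by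
      norm_num
    rwa [e] at h
  · have hlim : Tendsto (fun w : ℝ => Real.exp (w / 2) * (Real.cosh ((1 / 2) * w))⁻¹) atTop
        (𝓝 2) := by
      have e : ∀ w : ℝ, Real.exp (w / 2) * (Real.cosh ((1 / 2) * w))⁻¹
          = 2 * (1 + Real.exp (-w))⁻¹ := by
        intro w
        have : Real.exp (-w) * Real.exp (w / 2) = Real.exp (-(w / 2)) := by
          rw [← Real.exp_add]; ring_nf
        rw [Real.cosh_eq, show (1 / 2) * w = w / 2 by ring, ← this]
        have := Real.exp_pos (w / 2)
        have := Real.exp_pos (-w)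
        generalize Real.exp (-w) = y at *
        generalize Real.exp (w / 2) = x at *
        field_simp
      simp_rw [e]
      have : Tendsto (fun w : ℝ => 2 * (1 + Real.exp (-w))⁻¹) atTop (𝓝 (2 * (1 + 0)⁻¹)) :=
        ((Real.tendsto_exp_neg_atTop_nhds_zero.const_add 1).inv₀ (by norm_num)).const_mul 2
      simpa using this
    split_ifs with hk
    · rw [Finset.mem_insert, Finset.mem_singleton] at hk
      rcases hk with rfl | rfl
      · simpa using hlim
      · refine hlim.congr fun w => ?_
        rw [← Real.cosh_neg]
        push_cast
        ring_nf
    · have hk' : 0 < |(k : ℝ) + 1 / 2| - 1 / 2 := by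
        rw [Finset.mem_insert, Finset.mem_singleton, not_or] at hk
        rcases lt_or_gt_of_ne hk.1 with h | h
        · have : (k : ℝ) ≤ -2 := by
            have : k ≤ -2 := by omega
            exact_mod_cast this
          have := neg_le_abs ((k : ℝ) + 1 / 2)
          linarith
        · have : (1 : ℝ) ≤ k := by exact_mod_cast h
          have := le_abs_self ((k : ℝ) + 1 / 2)
          linarith
      refine squeeze_zero' (Eventually.of_forall fun w =>
        mul_nonneg (Real.exp_pos _).le (inv_pos.2 (Real.cosh_pos _)).le)
        ((eventually_ge_atTop 0).mono fun w hw => hb w k hw) ?_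
      have : Tendsto (fun w : ℝ => Real.exp (-((|(k : ℝ) + 1 / 2| - 1 / 2) * w))) atTop (𝓝 0) :=
        Real.tendsto_exp_neg_atTop_nhds_zero.comp (tendsto_id.const_mul_atTop hk')
      simpa using this.const_mul 2
  · filter_upwards [eventually_ge_atTop 1] with w hw k
    rw [Real.norm_of_nonneg (mul_nonneg (Real.exp_pos _).le (inv_pos.2 (Real.cosh_pos _)).le)]
    refine (hb w k (by linarith)).trans ?_
    rw [mul_assoc, ← Real.exp_add]
    gcongr
    have h1 := half_le_abs_int_add_half k
    have h2 : |(k : ℝ)| ≤ |(k : ℝ) + 1 / 2| + 1 / 2 := by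
      have := abs_sub ((k : ℝ) + 1 / 2) (1 / 2)
      rw [add_sub_cancel_right, abs_of_pos (by norm_num : (0 : ℝ) < 1 / 2)] at this
      exact this
    nlinarith

theorem tendsto_exp_mul_modParam :
    Tendsto (fun w => Real.exp w * modParam w) atTop (𝓝 16) := by
  have h := (tendsto_exp_mul_sechSum_half.div tendsto_sechSum_zero one_ne_zero).pow 2
  rw [show ((4 : ℝ) / 1) ^ 2 = 16 by norm_num] at h
  refine h.congr fun w => ?_
  have : Real.exp w = Real.exp (w / 2) ^ 2 := by rw [← Real.exp_nat_mul]; push_cast; ring_nf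
  rw [this, modParam, Pi.div_apply]
  ring

theorem tendsto_mul_modParam : Tendsto (fun w => w * modParam w) atTop (𝓝 0) := by
  have h1 : Tendsto (fun w : ℝ => w * Real.exp (-w)) atTop (𝓝 0) := by
    simpa using Real.tendsto_pow_mul_exp_neg_atTop_nhds_zero 1
  have h := h1.mul tendsto_exp_mul_modParam
  rw [zero_mul] at h
  refine h.congr fun w => ?_
  rw [mul_assoc, ← mul_assoc (Real.exp (-w)), ← Real.exp_add]
  simp

theorem tendsto_modParam : Tendsto modParam atTop (𝓝 0) := by
  refine squeeze_zero' ?_ ?_ tendsto_mul_modParam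
  · exact (eventually_gt_atTop 0).mono fun w hw => (modParam_pos hw).le
  · filter_upwards [eventually_ge_atTop 1] with w hw
    exact le_mul_of_one_le_left (modParam_pos (by linarith)).le hw

theorem tendsto_log_modParam :
    Tendsto (fun w => Real.log (modParam w / 16) + w) atTop (𝓝 0) := by
  have h := (tendsto_exp_mul_modParam.div_const 16).log (by norm_num)
  rw [div_self (by norm_num), Real.log_one] at h
  refine h.congr' ?_
  filter_upwards [eventually_gt_atTop 0] with w hw
  have := modParam_pos hw
  rw [mul_div_assoc, Real.log_mul (Real.exp_pos w).ne' (by positivity), Real.log_exp, add_comm]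

theorem one_le_ellF {x : ℝ} (h0 : 0 ≤ x) (h1 : x < 1) : 1 ≤ ellF x := by
  have h := (summable_mul_pow abs_wallisCoeff_sq_le_one
    (x := x) (by rwa [abs_of_nonneg h0])).le_tsum 0 fun n _ => by positivity
  simpa [wallisCoeff_zero, ellF] using h

theorem ellF_pos {x : ℝ} (h0 : 0 ≤ x) (h1 : x < 1) : 0 < ellF x :=
  one_pos.trans_le (one_le_ellF h0 h1)

theorem ellF_zero : ellF 0 = 1 := by
  rw [ellF, tsum_eq_single 0 (fun n hn => by simp [hn])]
  simp [wallisCoeff_zero]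

theorem ellF_lt_ellF {x y : ℝ} (h0 : 0 ≤ x) (hxy : x < y) (h1 : y < 1) : ellF x < ellF y := by
  have hy : 0 ≤ y := h0.trans hxy.le
  refine Summable.tsum_lt_tsum (i := 1) (fun n => ?_) ?_
    (summable_mul_pow abs_wallisCoeff_sq_le_one (by rw [abs_of_nonneg h0]; exact hxy.trans h1))
    (summable_mul_pow abs_wallisCoeff_sq_le_one (by rwa [abs_of_nonneg hy]))
  · dsimp only
    gcongr
  · have := pow_pos (wallisCoeff_pos 1) 2
    simpa using mul_lt_mul_of_pos_left hxy this

/-- The coefficients of the power series `x (1 - x) * deriv ellF x`. -/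
noncomputable def ellGCoeff : ℕ → ℝ
  | 0 => 0
  | n + 1 => wallisCoeff n ^ 2 / (4 * (n + 1))

/-- The power series `x (1 - x) * deriv ellF x`. -/
noncomputable def ellG (x : ℝ) : ℝ := ∑' n : ℕ, ellGCoeff n * x ^ n

theorem ellGCoeff_succ (n : ℕ) : ellGCoeff (n + 1) = wallisCoeff n ^ 2 / (4 * (n + 1)) := rfl

theorem ellGCoeff_succ_eq_sub (n : ℕ) :
    ellGCoeff (n + 1) = (n + 1) * wallisCoeff (n + 1) ^ 2 - n * wallisCoeff n ^ 2 := by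
  rw [ellGCoeff_succ, wallisCoeff_succ]
  field_simp
  ring

theorem abs_ellGCoeff_le_one (n : ℕ) : |ellGCoeff n| ≤ 1 := by
  cases n with
  | zero => simp [ellGCoeff]
  | succ n =>
    rw [ellGCoeff_succ, abs_of_nonneg (by positivity), div_le_one (by positivity)]
    have := wallisCoeff_sq_le_one n
    have : (0 : ℝ) ≤ n := n.cast_nonneg
    linarith

theorem ellG_zero : ellG 0 = 0 := by
  rw [ellG, tsum_eq_single 0 (fun n hn => by simp [hn])]
  simp [ellGCoeff]

theorem hasDerivAt_ellG {x : ℝ} (hx : |x| < 1) : HasDerivAt ellG (ellF x / 4) x := by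
  refine (hasDerivAt_tsum_mul_pow abs_ellGCoeff_le_one hx).congr_deriv ?_
  rw [ellF, ← tsum_div_const]
  refine tsum_congr fun n => ?_
  rw [ellGCoeff_succ]
  field_simp

theorem hasDerivAt_ellF {x : ℝ} (h0 : 0 < x) (h1 : x < 1) :
    HasDerivAt ellF (ellG x / (x * (1 - x))) x := by
  have hx : |x| < 1 := by rwa [abs_of_pos h0]
  refine (hasDerivAt_tsum_mul_pow abs_wallisCoeff_sq_le_one hx).congr_deriv ?_
  have h1' : (0 : ℝ) < 1 - x := by linarith
  rw [eq_div_iff (by positivity)]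
  have s1 := summable_succ_mul_pow abs_wallisCoeff_sq_le_one hx
  have s2 := summable_nat_mul_pow abs_wallisCoeff_sq_le_one hx
  have s3 := summable_mul_pow abs_ellGCoeff_le_one hx
  rw [ellG, s3.tsum_eq_zero_add]
  have e : (∑' n : ℕ, ((n : ℝ) + 1) * wallisCoeff (n + 1) ^ 2 * x ^ n) * x
      = ∑' n : ℕ, (n : ℝ) * wallisCoeff n ^ 2 * x ^ n := by
    rw [s2.tsum_eq_zero_add, ← tsum_mul_right]
    simp only [Nat.cast_zero, zero_mul, zero_add]
    refine tsum_congr fun n => ?_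
    push_cast
    ring
  have e2 : (∑' n : ℕ, ((n : ℝ) + 1) * wallisCoeff (n + 1) ^ 2 * x ^ n) * (x * (1 - x))
      = (∑' n : ℕ, ((n : ℝ) + 1) * wallisCoeff (n + 1) ^ 2 * x ^ n) * x
        - (∑' n : ℕ, (n : ℝ) * wallisCoeff n ^ 2 * x ^ n) * x := by
    rw [← e]; ring
  rw [e2, ← tsum_mul_right, ← tsum_mul_right, ← (s1.mul_right x).tsum_sub (s2.mul_right x)]
  simp only [ellGCoeff, zero_mul, zero_add]
  refine tsum_congr fun n => ?_
  rw [← ellGCoeff_succ, ellGCoeff_succ_eq_sub]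
  ring

theorem wallisCoeff_sq_mul_W (n : ℕ) :
    wallisCoeff n ^ 2 * (2 * n + 1) * Real.Wallis.W n = 1 := by
  induction n with
  | zero => simp [wallisCoeff, Real.Wallis.W]
  | succ n ih =>
    rw [Real.Wallis.W_succ, wallisCoeff_succ]
    refine Eq.trans ?_ ih
    push_cast
    field_simp
    ring

theorem tendsto_nat_mul_wallisCoeff_sq :
    Tendsto (fun n : ℕ => n * wallisCoeff n ^ 2) atTop (𝓝 (1 / π)) := by
  have h1 : Tendsto (fun n : ℕ => (n : ℝ) / (n + 1 / 2)) atTop (𝓝 1) :=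
    tendsto_natCast_div_add_atTop (1 / 2 : ℝ)
  have h2 := (h1.div_const 2).div Real.Wallis.tendsto_W_nhds_pi_div_two (by positivity)
  have e : (1 : ℝ) / 2 / (π / 2) = 1 / π := by field_simp
  rw [e] at h2
  refine h2.congr fun n => ?_
  have h3 := wallisCoeff_sq_mul_W n
  have h4 := Real.Wallis.W_pos n
  rw [Pi.div_apply, div_eq_iff h4.ne', mul_assoc, mul_comm (wallisCoeff n ^ 2 : ℝ)]
  have : (0 : ℝ) < 2 * n + 1 := by positivity
  field_simp
  linear_combination (-(n : ℝ)) * h3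

theorem sum_range_ellGCoeff (n : ℕ) :
    ∑ i ∈ Finset.range (n + 1), ellGCoeff i = n * wallisCoeff n ^ 2 := by
  induction n with
  | zero => simp [ellGCoeff]
  | succ n ih =>
    rw [Finset.sum_range_succ, ih, ellGCoeff_succ_eq_sub]
    push_cast
    ring

theorem tendsto_ellG_one : Tendsto ellG (𝓝[<] 1) (𝓝 (1 / π)) := by
  refine Real.tendsto_tsum_powerSeries_nhdsWithin_lt ?_
  rw [← tendsto_add_atTop_iff_nat 1]
  exact tendsto_nat_mul_wallisCoeff_sq.congr fun n => (sum_range_ellGCoeff n).symm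

theorem tendsto_one_sub_modParam : Tendsto (fun w => 1 - modParam w) atTop (𝓝[<] 1) := by
  refine tendsto_nhdsWithin_iff.2 ⟨?_, ?_⟩
  · simpa using tendsto_modParam.const_sub 1
  · filter_upwards [eventually_gt_atTop 0] with w hw
    have := modParam_pos hw
    simp [this]

/-- Legendre's relation for complete elliptic integrals. -/
theorem ellF_mul_ellG_add {t : ℝ} (h0 : 0 < t) (h1 : t < 1) :
    ellF t * ellG (1 - t) + ellG t * ellF (1 - t) = 1 / π := by
  set W : ℝ → ℝ := fun t => ellF t * ellG (1 - t) + ellG t * ellF (1 - t) with hW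
  have hd : ∀ x ∈ Set.Ioo (0 : ℝ) 1, HasDerivAt W 0 x := by
    rintro x ⟨hx0, hx1⟩
    have hs : HasDerivAt (fun x : ℝ => 1 - x) (-1) x := (hasDerivAt_id x).const_sub 1
    have a1 := hasDerivAt_ellF hx0 hx1
    have a2 := hasDerivAt_ellG (x := x) (by rwa [abs_of_pos hx0])
    have a3 := (hasDerivAt_ellF (x := 1 - x) (by linarith) (by linarith)).comp x hs
    have a4 := (hasDerivAt_ellG (x := 1 - x)
      (by rw [abs_of_pos (by linarith)]; linarith)).comp x hs
    refine ((a1.mul a4).add (a2.mul a3)).congr_deriv ?_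
    simp only [Function.comp_apply, sub_sub_cancel]
    have : 1 - x ≠ 0 := by linarith
    field_simp
    ring
  have hconst : ∀ x ∈ Set.Ioo (0 : ℝ) 1, W x = W t := fun x hx =>
    isOpen_Ioo.is_const_of_deriv_eq_zero isPreconnected_Ioo
      (fun y hy => (hd y hy).differentiableAt.differentiableWithinAt)
      (fun y hy => (hd y hy).deriv) hx ⟨h0, h1⟩
  have hlim : Tendsto (fun w => W (modParam w)) atTop (𝓝 (1 * (1 / π) + 0)) := by
    refine Tendsto.add (Tendsto.mul ?_ (tendsto_ellG_one.comp tendsto_one_sub_modParam)) ?_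
    · have hc : ContinuousAt ellF 0 :=
        (hasDerivAt_tsum_mul_pow abs_wallisCoeff_sq_le_one (x := 0) (by simp)).continuousAt
      have := hc.tendsto.comp tendsto_modParam
      rwa [ellF_zero] at this
    · have hO := (hasDerivAt_ellG (x := 0) (by simp)).isBigO_sub.comp_tendsto tendsto_modParam
      have hO2 := hO.mul (Asymptotics.isBigO_refl (fun w => w / π * sechSum 0 w) atTop)
      have hlim2 : Tendsto (fun w => modParam w * (w / π * sechSum 0 w)) atTop (𝓝 0) := by
        have := (tendsto_mul_modParam.mul tendsto_sechSum_zero).div_const π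
        simp only [zero_mul, zero_div] at this
        exact this.congr fun w => by ring
      have h3 := hO2.trans_tendsto (by simpa [Function.comp_def] using hlim2)
      refine h3.congr' ?_
      filter_upwards [eventually_gt_atTop 0] with w hw
      simp [ellG_zero, ellF_one_sub_modParam hw]
  have hev : (fun w => W (modParam w)) =ᶠ[atTop] fun _ => W t := by
    filter_upwards [eventually_gt_atTop 0] with w hw
    exact hconst _ ⟨modParam_pos hw, modParam_lt_one hw⟩
  have := tendsto_nhds_unique (hlim.congr' hev) tendsto_const_nhds
  rw [one_mul, add_zero] at this
  exact this.symm

/-- The lattice parameter attached to an elliptic modular parameter. -/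
noncomputable def latticeParam (t : ℝ) : ℝ := π * ellF (1 - t) / ellF t

theorem latticeParam_pos {t : ℝ} (h0 : 0 < t) (h1 : t < 1) : 0 < latticeParam t :=
  div_pos (mul_pos Real.pi_pos (ellF_pos (by linarith) (by linarith))) (ellF_pos h0.le h1)

theorem latticeParam_modParam {w : ℝ} (hw : 0 < w) : latticeParam (modParam w) = w := by
  have := sechSum_pos 0 hw
  rw [latticeParam, ellF_one_sub_modParam hw, ellF_modParam hw]
  field_simp

theorem latticeParam_lt {s t : ℝ} (h0 : 0 < s) (hst : s < t) (h1 : t < 1) :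
    latticeParam t < latticeParam s := by
  have a1 := ellF_lt_ellF h0.le hst h1
  have a2 := ellF_lt_ellF (x := 1 - t) (y := 1 - s) (by linarith) (by linarith) (by linarith)
  have a3 := ellF_pos h0.le (hst.trans h1)
  have a4 := ellF_pos (x := 1 - t) (by linarith) (by linarith)
  have := Real.pi_pos
  have a5 := a4.trans a2
  unfold latticeParam
  gcongr

theorem modParam_latticeParam {t : ℝ} (h0 : 0 < t) (h1 : t < 1) :
    modParam (latticeParam t) = t := by
  have hw := latticeParam_pos h0 h1
  have h := latticeParam_modParam hw
  rcases lt_trichotomy (modParam (latticeParam t)) t with hlt | heq | hgt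
  · exact absurd h (latticeParam_lt (modParam_pos hw) hlt h1).ne'
  · exact heq
  · exact absurd h (latticeParam_lt h0 hgt (modParam_lt_one hw)).ne

theorem hasDerivAt_latticeParam {t : ℝ} (h0 : 0 < t) (h1 : t < 1) :
    HasDerivAt latticeParam (-1 / (t * (1 - t) * ellF t ^ 2)) t := by
  have hs : HasDerivAt (fun x : ℝ => 1 - x) (-1) t := (hasDerivAt_id t).const_sub 1
  have a1 := hasDerivAt_ellF h0 h1
  have a3 := (hasDerivAt_ellF (x := 1 - t) (by linarith) (by linarith)).comp t hs
  have hF := ellF_pos h0.le h1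
  have hL := ellF_mul_ellG_add h0 h1
  refine ((a3.const_mul π).div a1 hF.ne').congr_deriv ?_
  simp only [Function.comp_apply, sub_sub_cancel]
  have h1' : 1 - t ≠ 0 := by linarith
  have hπ := Real.pi_ne_zero
  have hL' : π * (ellF t * ellG (1 - t) + ellG t * ellF (1 - t)) = 1 := by
    rw [hL]; field_simp
  field_simp
  linear_combination -hL'

/-- The power series `∑_{n ≥ 1} ((1/2)_n / n!)² xⁿ / n`. -/
noncomputable def ellL (x : ℝ) : ℝ := ∑' n : ℕ, wallisCoeff n ^ 2 / n * x ^ n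

theorem abs_wallisCoeff_sq_div_le_one (n : ℕ) : |wallisCoeff n ^ 2 / n| ≤ 1 := by
  rcases Nat.eq_zero_or_pos n with rfl | hn
  · simp
  · have : (1 : ℝ) ≤ n := by exact_mod_cast hn
    rw [abs_of_nonneg (by positivity), div_le_one (by positivity)]
    exact (wallisCoeff_sq_le_one n).trans this

theorem ellL_zero : ellL 0 = 0 := by
  rw [ellL, tsum_eq_single 0 (fun n hn => by simp [hn])]
  simp

theorem continuousAt_ellL_zero : ContinuousAt ellL 0 :=
  (hasDerivAt_tsum_mul_pow abs_wallisCoeff_sq_div_le_one (x := 0) (by simp)).continuousAt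

theorem hasDerivAt_ellL {x : ℝ} (h0 : 0 < x) (h1 : x < 1) :
    HasDerivAt ellL ((ellF x - 1) / x) x := by
  have hx : |x| < 1 := by rwa [abs_of_pos h0]
  refine (hasDerivAt_tsum_mul_pow abs_wallisCoeff_sq_div_le_one hx).congr_deriv ?_
  rw [eq_div_iff h0.ne', ellF,
    (summable_mul_pow abs_wallisCoeff_sq_le_one hx).tsum_eq_zero_add, ← tsum_mul_right]
  simp only [wallisCoeff_zero, one_pow, pow_zero, mul_one, add_sub_cancel_left]
  refine tsum_congr fun n => ?_
  push_cast
  field_simp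
  ring

theorem pochR_succ_left (a : ℝ) (n : ℕ) : pochR a (n + 1) = a * pochR (a + 1) n := by
  rw [pochR, Finset.prod_range_succ', pochR, mul_comm]
  congr 1
  · simp
  · refine Finset.prod_congr rfl fun i _ => ?_
    push_cast
    ring

theorem mul_hyp4F3_eq_ellL {x : ℝ} (hx : |x| < 1) :
    x / 4 * hyp4F3 (3 / 2) (3 / 2) 1 1 2 2 2 x = ellL x := by
  rw [ellL, (summable_mul_pow abs_wallisCoeff_sq_div_le_one hx).tsum_eq_zero_add, hyp4F3,
    ← tsum_mul_left]
  simp only [Nat.cast_zero, div_zero, zero_mul, zero_add]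
  refine tsum_congr fun n => ?_
  have e1 : pochR (3 / 2) n = 2 * (wallisCoeff (n + 1) * (n + 1).factorial) := by
    rw [← pochR_half, pochR_succ_left, show (1 / 2 + 1 : ℝ) = 3 / 2 by norm_num]
    ring
  have e2 : pochR 2 n = (n + 1).factorial := by
    rw [← pochR_one, pochR_succ_left]
    norm_num
  have : (n.factorial : ℝ) ≠ 0 := by exact_mod_cast n.factorial_ne_zero
  rw [e1, e2, pochR_one, Nat.factorial_succ]
  push_cast
  field_simp
  ring

/-- Coefficients of the inverse tangent integral `Im Li₂(iy)`. -/
noncomputable def tiCoeff (n : ℕ) : ℝ := (Complex.I ^ n).im / (n : ℝ) ^ 2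

/-- The inverse tangent integral `Im Li₂(iy)`. -/
noncomputable def invTanInt (y : ℝ) : ℝ := ∑' n : ℕ, tiCoeff n * y ^ n

theorem abs_tiCoeff_le (n : ℕ) : |tiCoeff n| ≤ 1 / (n : ℝ) ^ 2 := by
  rw [tiCoeff, abs_div, abs_of_nonneg (by positivity : (0 : ℝ) ≤ (n : ℝ) ^ 2)]
  have : |(Complex.I ^ n).im| ≤ 1 := (Complex.abs_im_le_norm _).trans (by simp)
  gcongr

theorem abs_tiCoeff_le_one (n : ℕ) : |tiCoeff n| ≤ 1 := by
  refine (abs_tiCoeff_le n).trans ?_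
  rcases Nat.eq_zero_or_pos n with rfl | hn
  · simp
  · have : (1 : ℝ) ≤ n := by exact_mod_cast hn
    rw [div_le_one (by positivity)]
    exact one_le_pow₀ this

theorem norm_tiCoeff_mul_pow_le {y : ℝ} (hy : |y| ≤ 1) (n : ℕ) :
    ‖tiCoeff n * y ^ n‖ ≤ 1 / (n : ℝ) ^ 2 := by
  rw [Real.norm_eq_abs, abs_mul, abs_pow]
  exact (mul_le_of_le_one_right (abs_nonneg _) (pow_le_one₀ (abs_nonneg _) hy)).trans
    (abs_tiCoeff_le n)

theorem summable_one_div_nat_sq : Summable fun n : ℕ => 1 / (n : ℝ) ^ 2 :=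
  Real.summable_one_div_nat_pow.2 one_lt_two

theorem summable_tiCoeff {y : ℝ} (hy : |y| ≤ 1) : Summable fun n => tiCoeff n * y ^ n :=
  .of_norm_bounded summable_one_div_nat_sq (norm_tiCoeff_mul_pow_le hy)

theorem continuousOn_invTanInt : ContinuousOn invTanInt {y | |y| ≤ 1} :=
  continuousOn_tsum (fun n => by fun_prop) summable_one_div_nat_sq
    fun n _ hy => norm_tiCoeff_mul_pow_le hy n

theorem invTanInt_neg (y : ℝ) : invTanInt (-y) = -invTanInt y := by
  rw [invTanInt, invTanInt, ← tsum_neg]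
  refine tsum_congr fun n => ?_
  have h : (-1 : ℝ) ^ n * (Complex.I ^ n).im = -(Complex.I ^ n).im := by
    have h1 : (-Complex.I) ^ n = (starRingEnd ℂ) (Complex.I ^ n) := by simp
    have h2 := congrArg Complex.im h1
    rw [neg_pow, Complex.conj_im] at h2
    rw [← h2, ← Complex.im_ofReal_mul]
    push_cast
    rfl
  rw [neg_pow, tiCoeff]
  linear_combination y ^ n / (n : ℝ) ^ 2 * h

theorem exists_abs_invTanInt_le : ∃ K, 0 ≤ K ∧ ∀ y : ℝ, |y| ≤ 1 → |invTanInt y| ≤ K * |y| := by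
  refine ⟨∑' n : ℕ, 1 / (n : ℝ) ^ 2, tsum_nonneg fun n => by positivity, fun y hy => ?_⟩
  rw [← tsum_mul_right, ← Real.norm_eq_abs]
  refine tsum_of_norm_bounded (summable_one_div_nat_sq.mul_right _).hasSum fun n => ?_
  rcases Nat.eq_zero_or_pos n with rfl | hn
  · simp [tiCoeff]
  · rw [Real.norm_eq_abs, abs_mul, abs_pow]
    have := pow_le_of_le_one (abs_nonneg y) hy hn.ne'
    exact mul_le_mul (abs_tiCoeff_le n) this (by positivity) (by positivity)

theorem li2_I_mul_im {y : ℝ} (hy : |y| ≤ 1) : (li2 (Complex.I * y)).im = invTanInt y := by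
  have e : ∀ n : ℕ, ((Complex.I * y) ^ (n + 1) / ((n : ℂ) + 1) ^ 2).im
      = tiCoeff (n + 1) * y ^ (n + 1) := by
    intro n
    have : (Complex.I * y) ^ (n + 1) / ((n : ℂ) + 1) ^ 2
        = ((y ^ (n + 1) / ((n : ℝ) + 1) ^ 2 : ℝ) : ℂ) * Complex.I ^ (n + 1) := by
      push_cast
      ring
    rw [this, Complex.im_ofReal_mul, tiCoeff]
    push_cast
    ring
  have hs : Summable fun n : ℕ => (Complex.I * y) ^ (n + 1) / ((n : ℂ) + 1) ^ 2 := by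
    refine .of_norm_bounded ((summable_nat_add_iff 1).2 summable_one_div_nat_sq) fun n => ?_
    have h1 : ‖(n : ℂ) + 1‖ = (n : ℝ) + 1 := by
      have := Complex.norm_natCast (n + 1)
      push_cast at this
      exact this
    rw [norm_div, norm_pow, norm_pow, h1, norm_mul, Complex.norm_I, one_mul, Complex.norm_real,
      Real.norm_eq_abs]
    have := pow_le_one₀ (n := n + 1) (abs_nonneg y) hy
    push_cast
    gcongr
  rw [li2, Complex.im_tsum, tsum_congr e, invTanInt, (summable_tiCoeff hy).tsum_eq_zero_add]
  · simp [tiCoeff]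
  · exact hs

theorem Complex.arg_one_sub_I_mul (y : ℝ) : Complex.arg (1 - Complex.I * y) = -Real.arctan y := by
  rw [Complex.arg_of_re_nonneg (by simp), Real.arctan_eq_arcsin, ← Real.arcsin_neg]
  congr 1
  have : ‖(1 : ℂ) - Complex.I * y‖ = √(1 + y ^ 2) := by
    rw [Complex.norm_eq_sqrt_sq_add_sq]
    simp
  rw [this]
  simp [neg_div]

theorem hasDerivAt_invTanInt {y : ℝ} (h0 : 0 < y) (h1 : y < 1) :
    HasDerivAt invTanInt (Real.arctan y / y) y := by
  have hy : |y| < 1 := by rwa [abs_of_pos h0]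
  refine (hasDerivAt_tsum_mul_pow abs_tiCoeff_le_one hy).congr_deriv ?_
  rw [eq_div_iff h0.ne', ← tsum_mul_right]
  have h := Complex.hasSum_im
    (Complex.hasSum_taylorSeries_neg_log (z := Complex.I * y) (by simpa using hy))
  rw [Complex.neg_im, Complex.log_im, Complex.arg_one_sub_I_mul, neg_neg] at h
  rw [← h.tsum_eq, h.summable.tsum_eq_zero_add]
  simp only [pow_zero, Nat.cast_zero, div_zero, Complex.zero_im, zero_add]
  refine tsum_congr fun n => ?_
  have : (Complex.I * y) ^ (n + 1) / ((n + 1 : ℕ) : ℂ)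
      = ((y ^ (n + 1) / ((n : ℝ) + 1) : ℝ) : ℂ) * Complex.I ^ (n + 1) := by
    push_cast
    ring
  rw [this, Complex.im_ofReal_mul, tiCoeff]
  push_cast
  field_simp
  ring

/-- The function `v ↦ D(i e⁻ᵛ)`. -/
noncomputable def bwI (v : ℝ) : ℝ :=
  invTanInt (Real.exp (-|v|)) + |v| * Real.arctan (Real.exp (-|v|))

theorem abs_exp_neg_abs_le_one (v : ℝ) : |Real.exp (-|v|)| ≤ 1 := by
  rw [Real.abs_exp, Real.exp_le_one_iff]
  simp

theorem blochWigner_I_mul_exp (v : ℝ) :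
    blochWigner (Complex.I * (Real.exp (-v) : ℝ)) = bwI v := by
  have hn : ‖Complex.I * (Real.exp (-v) : ℝ)‖ = Real.exp (-v) := by
    rw [norm_mul, Complex.norm_I, one_mul, Complex.norm_real, Real.norm_eq_abs, Real.abs_exp]
  have hab := abs_exp_neg_abs_le_one v
  rw [blochWigner, hn, bwI]
  split_ifs with h <;> rw [Real.exp_le_one_iff] at h
  · have hv : |v| = v := abs_of_nonneg (by linarith)
    rw [hv] at hab ⊢
    rw [li2_I_mul_im hab, Real.log_exp, Complex.arg_one_sub_I_mul]
    ring
  · have hv : |v| = -v := abs_of_neg (by linarith)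
    have hinv : (Complex.I * (Real.exp (-v) : ℝ))⁻¹ = Complex.I * ((-Real.exp v : ℝ) : ℂ) := by
      rw [mul_inv, Complex.inv_I, ← Complex.ofReal_inv, ← Real.exp_neg, neg_neg]
      push_cast
      ring
    rw [hv, neg_neg] at hab ⊢
    rw [norm_inv, hn, hinv, li2_I_mul_im (by rwa [abs_neg]), Complex.arg_one_sub_I_mul,
      ← Real.exp_neg, Real.log_exp, invTanInt_neg, Real.arctan_neg]
    ring

theorem bwI_neg (v : ℝ) : bwI (-v) = bwI v := by simp [bwI]

theorem continuous_bwI : Continuous bwI := by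
  refine .add ?_ (by fun_prop)
  exact continuousOn_invTanInt.comp_continuous (by fun_prop) abs_exp_neg_abs_le_one

theorem arctan_le_self {x : ℝ} (hx : 0 ≤ x) : Real.arctan x ≤ x := by
  have h := Real.le_tan (Real.arctan_nonneg.2 hx) (Real.arctan_lt_pi_div_two x)
  rwa [Real.tan_arctan] at h

theorem exists_abs_bwI_le : ∃ K, ∀ v, |bwI v| ≤ K * Real.exp (-(|v| / 2)) := by
  obtain ⟨K, hK0, hK⟩ := exists_abs_invTanInt_le
  refine ⟨K + 2, fun v => ?_⟩
  set a := |v| with ha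
  have ha0 : 0 ≤ a := abs_nonneg v
  have h1 := hK _ (abs_exp_neg_abs_le_one v)
  rw [Real.abs_exp, ← ha] at h1
  have h2 : |Real.arctan (Real.exp (-a))| ≤ Real.exp (-a) := by
    rw [abs_of_nonneg (Real.arctan_nonneg.2 (Real.exp_pos _).le)]
    exact arctan_le_self (Real.exp_pos _).le
  have e : Real.exp (-a) = Real.exp (-(a / 2)) * Real.exp (-(a / 2)) := by
    rw [← Real.exp_add]; ring_nf
  have h3 : a * Real.exp (-(a / 2)) ≤ 2 := by
    have := Real.add_one_le_exp (a / 2)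
    rw [Real.exp_neg, ← div_eq_mul_inv, div_le_iff₀ (Real.exp_pos _)]
    linarith
  have h4 : Real.exp (-a) ≤ Real.exp (-(a / 2)) := by gcongr; linarith
  have hp := Real.exp_pos (-(a / 2))
  calc |bwI v| ≤ K * Real.exp (-a) + a * Real.exp (-a) := by
        rw [bwI, ← ha]
        refine (abs_add_le _ _).trans (add_le_add h1 ?_)
        rw [abs_mul, abs_of_nonneg ha0]
        gcongr
    _ ≤ K * Real.exp (-(a / 2)) + 2 * Real.exp (-(a / 2)) := by
        refine add_le_add (by gcongr) ?_
        rw [e, ← mul_assoc]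
        gcongr
    _ = _ := by ring

theorem hasDerivAt_bwI_of_pos {v : ℝ} (hv : 0 < v) :
    HasDerivAt bwI (-(v / 2) / Real.cosh v) v := by
  have he1 : Real.exp (-v) < 1 := by simpa using hv
  have hE : HasDerivAt (fun v => Real.exp (-v)) (-Real.exp (-v)) v := by
    simpa using (hasDerivAt_neg v).exp
  have h1 := (hasDerivAt_invTanInt (Real.exp_pos _) he1).comp v hE
  have h2 := (hasDerivAt_id v).mul (hE.arctan)
  have h3 := h1.add h2
  refine (h3.congr_of_eventuallyEq ?_).congr_deriv ?_
  · filter_upwards [lt_mem_nhds hv] with u hu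
    simp [bwI, abs_of_pos hu]
  · have e : Real.cosh v = (1 + Real.exp (-v) ^ 2) / (2 * Real.exp (-v)) := by
      rw [Real.cosh_eq, Real.exp_neg]
      have := Real.exp_pos v
      field_simp
    rw [e]
    have := Real.exp_pos (-v)
    simp only [id_eq]
    field_simp
    ring

theorem hasDerivAt_bwI (v : ℝ) : HasDerivAt bwI (-(v / 2) / Real.cosh v) v := by
  refine hasDerivAt_of_hasDerivAt_of_ne' (x := 0) (g := fun v => -(v / 2) / Real.cosh v)
    (fun y hy => ?_) continuous_bwI.continuousAt ?_ v
  · rcases hy.lt_or_gt with h | h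
    · have h1 := (hasDerivAt_bwI_of_pos (neg_pos.2 h)).comp y (hasDerivAt_neg y)
      refine (h1.congr_of_eventuallyEq (.of_forall fun u => (bwI_neg u).symm)).congr_deriv ?_
      rw [Real.cosh_neg]
      ring
    · exact hasDerivAt_bwI_of_pos h
  · exact (Continuous.div (by fun_prop) Real.continuous_cosh
      fun x => (Real.cosh_pos x).ne').continuousAt

theorem summable_bwI_comp {w : ℝ} (hw : 0 < w) {φ : ℤ → ℝ} (hφ : ∀ n : ℤ, |(n : ℝ)| ≤ |φ n|) :
    Summable fun n : ℤ => bwI (φ n * w) := by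
  obtain ⟨K, hK⟩ := exists_abs_bwI_le
  have hK0 : 0 ≤ K := nonneg_of_mul_nonneg_left ((abs_nonneg _).trans (hK 0)) (Real.exp_pos _)
  refine .of_norm_bounded ((summable_exp_neg_mul_abs_int (half_pos hw)).mul_left K) fun n => ?_
  refine (hK _).trans ?_
  rw [abs_mul, abs_of_pos hw]
  have := mul_le_mul_of_nonneg_right (hφ n) hw.le
  gcongr
  linarith

/-- The lattice sum `∑ₙ D(i e⁻ⁿʷ)`. -/
noncomputable def bwSum (w : ℝ) : ℝ := ∑' n : ℤ, bwI (n * w)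

theorem abs_int_le_abs_two_mul (n : ℤ) : |(n : ℝ)| ≤ |2 * (n : ℝ)| := by
  rw [abs_mul, abs_two]
  linarith [abs_nonneg (n : ℝ)]

theorem abs_int_le_abs_two_mul_add_one (n : ℤ) : |(n : ℝ)| ≤ |2 * (n : ℝ) + 1| := by
  have : |n| ≤ |2 * n + 1| := by
    rcases abs_cases n with h | h <;> rcases abs_cases (2 * n + 1) with h' | h' <;> omega
  exact_mod_cast this

theorem bwSum_eq_even_add_odd {w : ℝ} (hw : 0 < w) :
    bwSum w = (∑' n : ℤ, bwI (2 * n * w)) + ∑' n : ℤ, bwI ((2 * n + 1) * w) := by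
  have he := (summable_bwI_comp hw abs_int_le_abs_two_mul).hasSum
  have ho := (summable_bwI_comp hw abs_int_le_abs_two_mul_add_one).hasSum
  have i0 : Function.Injective fun n : ℤ => 2 * n := mul_right_injective₀ two_ne_zero
  have i1 : Function.Injective fun n : ℤ => 2 * n + 1 := (add_left_injective 1).comp i0
  have hc : IsCompl (Set.range fun n : ℤ => 2 * n) (Set.range fun n : ℤ => 2 * n + 1) := by
    simpa [Function.comp_def] using Int.isCompl_even_odd
  have he' : HasSum ((fun n : ℤ => bwI (n * w)) ∘ fun n : ℤ => 2 * n)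
      (∑' n : ℤ, bwI (2 * n * w)) := by
    simpa [Function.comp_def] using he
  have ho' : HasSum ((fun n : ℤ => bwI (n * w)) ∘ fun n : ℤ => 2 * n + 1)
      (∑' n : ℤ, bwI ((2 * n + 1) * w)) := by
    simpa [Function.comp_def] using ho
  exact (HasSum.add_isCompl hc (i0.hasSum_range_iff.2 he') (i1.hasSum_range_iff.2 ho')).tsum_eq

theorem ellipticDilog_add_eq_bwSum {w : ℝ} (hw : 0 < w) :
    ellipticDilog (Real.exp (-(2 * w))) Complex.I
      + ellipticDilog (Real.exp (-(2 * w))) (Complex.I * (Real.sqrt (Real.exp (-(2 * w))) : ℂ))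
      = bwSum w := by
  have hz : ∀ n : ℤ, ((Real.exp (-(2 * w)) : ℝ) : ℂ) ^ n = ((Real.exp (-(2 * n * w)) : ℝ) : ℂ) := by
    intro n
    rw [← Complex.ofReal_zpow, ← Real.rpow_intCast, ← Real.exp_mul]
    ring_nf
  have hs : Real.sqrt (Real.exp (-(2 * w))) = Real.exp (-w) := by
    rw [← Real.exp_half]
    ring_nf
  rw [bwSum_eq_even_add_odd hw, ellipticDilog, ellipticDilog]
  congr 1 <;> refine tsum_congr fun n => ?_
  · rw [hz, blochWigner_I_mul_exp]
  · rw [hz, hs, mul_assoc, ← Complex.ofReal_mul, ← Real.exp_add, ← blochWigner_I_mul_exp]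
    ring_nf

theorem hasDerivAt_bwSum {w : ℝ} (hw : 0 < w) :
    HasDerivAt bwSum (-(w / 8) * (sechSum (1 / 2) w ^ 2 * sechSum 0 w)) w := by
  have hu : Summable fun n : ℤ => w * ((n : ℝ) ^ 2 / Real.cosh (n * (w / 2))) :=
    (hasSum_sq_div_cosh (half_pos hw)).summable.mul_left w
  have h := hasDerivAt_tsum_of_isPreconnected (g := fun (n : ℤ) (y : ℝ) => bwI (n * y))
    (g' := fun n y => n * (-(n * y / 2) / Real.cosh (n * y))) hu
    (isOpen_Ioo (a := w / 2) (b := 2 * w)) isPreconnected_Ioo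
    (fun n y _ => ?_) (fun n y hy => ?_) (y₀ := w) (y := w) ⟨by linarith, by linarith⟩
    (summable_bwI_comp hw fun n => le_rfl) ⟨by linarith, by linarith⟩
  · refine h.congr_deriv ?_
    have h2 := ((hasSum_sq_div_cosh hw).mul_left (-(w / 2))).tsum_eq
    rw [show -(w / 8) * (sechSum (1 / 2) w ^ 2 * sechSum 0 w)
      = -(w / 2) * (sechSum (1 / 2) w ^ 2 * sechSum 0 w / 4) by ring, ← h2]
    exact tsum_congr fun n => by ring
  · refine ((hasDerivAt_bwI (n * y)).comp y ((hasDerivAt_id y).const_mul (n : ℝ))).congr_deriv ?_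
    ring
  · have hy0 : 0 < y := by linarith [hy.1]
    have e : (n : ℝ) * (-(n * y / 2) / Real.cosh (n * y))
        = -(y / 2 * ((n : ℝ) ^ 2 / Real.cosh (n * y))) := by ring
    have hc := Real.cosh_pos (n * y)
    have hc2 := Real.cosh_pos (n * (w / 2))
    rw [e, norm_neg, Real.norm_eq_abs, abs_of_nonneg (by positivity)]
    have hle : Real.cosh (n * (w / 2)) ≤ Real.cosh (n * y) := by
      rw [Real.cosh_le_cosh, abs_mul, abs_mul, abs_of_pos hy0, abs_of_pos (half_pos hw)]
      exact mul_le_mul_of_nonneg_left hy.1.le (abs_nonneg _)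
    have : y / 2 ≤ w := by linarith [hy.2]
    gcongr

theorem abs_deriv_deriv_bwI_le (x : ℝ) :
    |-(1 / 2) / Real.cosh x + x / 2 * Real.sinh x / Real.cosh x ^ 2|
      ≤ 3 * Real.exp (-(|x| / 2)) := by
  have hc := Real.cosh_pos x
  have h1 := inv_cosh_le x
  have hs : |Real.sinh x| ≤ Real.cosh x := by
    rw [abs_le]
    constructor <;> linarith [Real.sinh_lt_cosh x, Real.sinh_lt_cosh (-x), Real.sinh_neg x,
      Real.cosh_neg x]
  have e : Real.exp (-|x|) = Real.exp (-(|x| / 2)) * Real.exp (-(|x| / 2)) := by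
    rw [← Real.exp_add]; ring_nf
  have hp := Real.exp_pos (-(|x| / 2))
  have h3 : (|x| + 1) * Real.exp (-(|x| / 2)) ≤ 3 := by
    have := Real.add_one_le_exp (|x| / 2)
    rw [Real.exp_neg, ← div_eq_mul_inv, div_le_iff₀ (Real.exp_pos _)]
    linarith [abs_nonneg x]
  calc _ ≤ 1 / 2 * (Real.cosh x)⁻¹ + |x| / 2 * (Real.cosh x)⁻¹ := by
        refine (abs_add_le _ _).trans (add_le_add ?_ ?_)
        · rw [abs_div, abs_neg, abs_of_pos hc, abs_of_pos one_half_pos]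
          exact le_rfl
        · rw [abs_div, abs_mul, abs_div, abs_two, abs_of_pos (pow_pos hc 2), mul_div_assoc]
          gcongr
          rw [div_le_iff₀ (pow_pos hc 2)]
          field_simp
          linarith
    _ = (|x| + 1) / 2 * (Real.cosh x)⁻¹ := by ring
    _ ≤ (|x| + 1) / 2 * (2 * Real.exp (-|x|)) := by gcongr
    _ = (|x| + 1) * Real.exp (-(|x| / 2)) * Real.exp (-(|x| / 2)) := by rw [e]; ring
    _ ≤ _ := by gcongr

theorem hasDerivAt_deriv_bwI (x : ℝ) :
    HasDerivAt (fun v => -(v / 2) / Real.cosh v)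
      (-(1 / 2) / Real.cosh x + x / 2 * Real.sinh x / Real.cosh x ^ 2) x := by
  have hc := (Real.cosh_pos x).ne'
  refine (((hasDerivAt_id x).div_const 2).neg.div (Real.hasDerivAt_cosh x) hc).congr_deriv ?_
  simp only [Pi.neg_apply, id_eq]
  field_simp
  ring

/-- Second difference estimate from a bound on the second derivative. -/
theorem abs_second_diff_le {f f' f'' : ℝ → ℝ} (hf : ∀ x, HasDerivAt f (f' x) x)
    (hf' : ∀ x, HasDerivAt f' (f'' x) x) {b h C : ℝ} (hh : 0 ≤ h)
    (hC : ∀ x, |x - b| ≤ h → |f'' x| ≤ C) :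
    |f (b + h) - 2 * f b + f (b - h)| ≤ 2 * C * h ^ 2 := by
  have hd' : ∀ u ∈ Set.Icc 0 h, |f' (b + u) - f' (b - u)| ≤ C * (2 * h) := by
    intro u hu
    have := (convex_Icc (b - h) (b + h)).norm_image_sub_le_of_norm_hasDerivWithin_le
      (f := f') (f' := f'') (C := C) (fun x _ => (hf' x).hasDerivWithinAt)
      (fun x hx => hC x (abs_le.2 ⟨by linarith [hx.1], by linarith [hx.2]⟩))
      (x := b - u) (y := b + u) ⟨by linarith [hu.2], by linarith [hu.1]⟩
      ⟨by linarith [hu.1], by linarith [hu.2]⟩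
    have hC0 : 0 ≤ C := (abs_nonneg _).trans (hC b (by simpa using hh))
    rw [Real.norm_eq_abs, Real.norm_eq_abs] at this
    refine this.trans (mul_le_mul_of_nonneg_left ?_ hC0)
    rw [abs_of_nonneg] <;> linarith [hu.1, hu.2]
  have hd : ∀ u, HasDerivAt (fun u => f (b + u) + f (b - u)) (f' (b + u) - f' (b - u)) u := by
    intro u
    have h1 := (hf (b + u)).comp u ((hasDerivAt_id u).const_add b)
    have h2 := (hf (b - u)).comp u ((hasDerivAt_id u).const_sub b)
    exact (h1.add h2).congr_deriv (by ring)
  have := (convex_Icc 0 h).norm_image_sub_le_of_norm_hasDerivWithin_le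
    (fun x _ => (hd x).hasDerivWithinAt) hd'
    (x := 0) (y := h) ⟨le_rfl, hh⟩ ⟨hh, le_rfl⟩
  simp only [add_zero, sub_zero, Real.norm_eq_abs, abs_of_nonneg hh] at this
  calc _ = |f (b + h) + f (b - h) - (f b + f b)| := by ring_nf
    _ ≤ _ := this
    _ = _ := by ring

theorem two_mul_bwSum_sub_eq {w : ℝ} (hw : 0 < w) :
    HasSum (fun n : ℤ => bwI ((2 * n + 1) * w + w) - 2 * bwI ((2 * n + 1) * w)
      + bwI ((2 * n + 1) * w - w)) (2 * (2 * bwSum (2 * w) - bwSum w)) := by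
  have he := (summable_bwI_comp hw abs_int_le_abs_two_mul).hasSum
  have ho := (summable_bwI_comp hw abs_int_le_abs_two_mul_add_one).hasSum
  have hs := (Equiv.addRight (1 : ℤ)).hasSum_iff.2 he
  have h := (hs.sub (ho.mul_left 2)).add he
  have e : (∑' n : ℤ, bwI (2 * n * w)) = bwSum (2 * w) :=
    tsum_congr fun n => by ring_nf
  rw [e] at h
  have e2 := bwSum_eq_even_add_odd hw
  rw [e] at e2
  rw [show 2 * (2 * bwSum (2 * w) - bwSum w)
    = bwSum (2 * w) - 2 * ∑' n : ℤ, bwI ((2 * n + 1) * w) + bwSum (2 * w) by rw [e2]; ring]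
  refine h.congr_fun fun n => ?_
  simp only [Function.comp_apply, Equiv.coe_addRight, Int.cast_add, Int.cast_one]
  ring_nf

theorem exp_neg_abs_le_inv_cosh (x : ℝ) : Real.exp (-|x|) ≤ (Real.cosh x)⁻¹ := by
  rw [Real.exp_neg, ← Real.cosh_abs]
  have h := Real.cosh_pos |x|
  gcongr
  rw [Real.cosh_eq]
  have : Real.exp (-|x|) ≤ Real.exp |x| := by
    gcongr
    linarith [abs_nonneg x]
  linarith

theorem abs_two_mul_bwSum_sub_le {w : ℝ} (hw : 0 < w) :
    |2 * bwSum (2 * w) - bwSum w| ≤ 3 * Real.exp (w / 2) * w ^ 2 * sechSum 0 (w / 2) := by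
  have hb : ∀ n : ℤ, ‖bwI ((2 * n + 1) * w + w) - 2 * bwI ((2 * n + 1) * w)
      + bwI ((2 * n + 1) * w - w)‖
      ≤ 2 * (3 * Real.exp (w / 2) * w ^ 2) * (Real.cosh ((n + 0) * (w / 2)))⁻¹ := by
    intro n
    have h := abs_second_diff_le hasDerivAt_bwI hasDerivAt_deriv_bwI (b := (2 * n + 1) * w)
      (C := 3 * (Real.exp (w / 2) * Real.exp (-|n * (w / 2)|))) hw.le (fun x hx => ?_)
    · refine h.trans ?_
      have := exp_neg_abs_le_inv_cosh (n * (w / 2))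
      rw [add_zero]
      calc _ = 2 * (3 * Real.exp (w / 2) * w ^ 2) * Real.exp (-|n * (w / 2)|) := by ring
        _ ≤ _ := by gcongr
    · refine (abs_deriv_deriv_bwI_le x).trans ?_
      rw [← Real.exp_add]
      have h1 := abs_sub_abs_le_abs_sub ((2 * (n : ℝ) + 1) * w) x
      rw [abs_sub_comm, abs_mul, abs_of_pos hw] at h1
      have h2 := mul_le_mul_of_nonneg_right (abs_int_le_abs_two_mul_add_one n) hw.le
      rw [abs_mul, abs_of_pos (half_pos hw)]
      gcongr
      linarith
  have h := tsum_of_norm_bounded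
    ((summable_inv_cosh 0 (half_pos hw)).hasSum.mul_left _) hb
  rw [(two_mul_bwSum_sub_eq hw).tsum_eq, Real.norm_eq_abs, abs_mul, abs_two] at h
  have : sechSum 0 (w / 2) = ∑' n : ℤ, (Real.cosh ((n + 0) * (w / 2)))⁻¹ := rfl
  rw [this]
  linarith

theorem tendsto_two_mul_bwSum_sub :
    Tendsto (fun s : ℝ => 2 * bwSum (2 * (π ^ 2 / s)) - bwSum (π ^ 2 / s)) atTop (𝓝 0) := by
  have h0 : Tendsto (fun s : ℝ => π ^ 2 / s) atTop (𝓝 0) := tendsto_const_nhds.div_atTop tendsto_id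
  have h1 : Tendsto (fun s : ℝ => Real.exp (π ^ 2 / s / 2)) atTop (𝓝 1) := by
    have := (Real.continuous_exp.tendsto _).comp (h0.div_const 2)
    simpa [Function.comp_def] using this
  have h2 := tendsto_sechSum_zero.comp (tendsto_id.const_mul_atTop (two_pos (α := ℝ)))
  have h3 := ((h1.const_mul 3).mul (h0.const_mul (2 * π))).mul h2
  simp only [mul_zero, zero_mul] at h3
  refine squeeze_zero_norm' ?_ h3
  filter_upwards [eventually_gt_atTop 0] with s hs
  have hw : 0 < π ^ 2 / s := by positivity
  refine (abs_two_mul_bwSum_sub_le hw).trans (le_of_eq ?_)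
  rw [sechSum_zero_eq (half_pos hw)]
  have e : π ^ 2 / (π ^ 2 / s / 2) = 2 * s := by
    field_simp
  rw [e]
  simp only [Function.comp_apply, id_eq]
  field_simp

/-- The hypergeometric side of the evaluation of the elliptic dilogarithm. -/
noncomputable def bwHyp (t : ℝ) : ℝ := -(π / 8) * (Real.log ((1 - t) / 16) + ellL (1 - t))

theorem hasDerivAt_bwHyp {t : ℝ} (h0 : 0 < t) (h1 : t < 1) :
    HasDerivAt bwHyp (π / 8 * (ellF (1 - t) / (1 - t))) t := by
  have ht : 1 - t ≠ 0 := by linarith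
  have hs : HasDerivAt (fun t : ℝ => 1 - t) (-1) t := by
    simpa using (hasDerivAt_id t).const_sub 1
  have hl := (hs.div_const 16).log (by positivity)
  have hL := (hasDerivAt_ellL (x := 1 - t) (by linarith) (by linarith)).comp t hs
  refine ((hl.add hL).const_mul (-(π / 8))).congr_deriv ?_
  field_simp
  ring

theorem hasDerivAt_bwSum_latticeParam {t : ℝ} (h0 : 0 < t) (h1 : t < 1) :
    HasDerivAt (fun t => bwSum (latticeParam t)) (π / 8 * (ellF (1 - t) / (1 - t))) t := by
  have hw := latticeParam_pos h0 h1
  refine ((hasDerivAt_bwSum hw).comp t (hasDerivAt_latticeParam h0 h1)).congr_deriv ?_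
  have hm := modParam_latticeParam h0 h1
  have hF : ellF t = sechSum 0 (latticeParam t) := by
    rw [← ellF_modParam hw, hm]
  have hF0 := (ellF_pos h0.le h1).ne'
  have hsq : sechSum (1 / 2) (latticeParam t) ^ 2 = t * ellF t ^ 2 := by
    rw [modParam, ← hF, div_pow, div_eq_iff (pow_ne_zero 2 hF0)] at hm
    exact hm
  rw [hsq, ← hF, latticeParam]
  have ht : 1 - t ≠ 0 := by linarith
  field_simp

theorem exists_bwHyp_sub_bwSum_eq :
    ∃ c, ∀ t, 0 < t → t < 1 → bwHyp t - bwSum (latticeParam t) = c := by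
  have hd : ∀ t ∈ Set.Ioo (0 : ℝ) 1, HasDerivAt (fun t => bwHyp t - bwSum (latticeParam t)) 0 t :=
    fun t ht => ((hasDerivAt_bwHyp ht.1 ht.2).sub
      (hasDerivAt_bwSum_latticeParam ht.1 ht.2)).congr_deriv (sub_self _)
  obtain ⟨c, hc⟩ := isOpen_Ioo.exists_is_const_of_deriv_eq_zero isPreconnected_Ioo
    (fun t ht => (hd t ht).differentiableAt.differentiableWithinAt) fun t ht => (hd t ht).deriv
  exact ⟨c, fun t h0 h1 => hc t ⟨h0, h1⟩⟩

theorem bwHyp_eq_bwSum {t : ℝ} (h0 : 0 < t) (h1 : t < 1) :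
    bwHyp t = bwSum (latticeParam t) := by
  obtain ⟨c, hc⟩ := exists_bwHyp_sub_bwSum_eq
  have hlim : Tendsto (fun s : ℝ => bwSum (π ^ 2 / s) - π / 8 * s) atTop (𝓝 (-c)) := by
    have hL : Tendsto (fun s => ellL (modParam s)) atTop (𝓝 0) := by
      have := continuousAt_ellL_zero.tendsto.comp tendsto_modParam
      rwa [ellL_zero] at this
    have h := ((tendsto_log_modParam.add hL).const_mul (-(π / 8))).sub_const c
    rw [add_zero, mul_zero, zero_sub] at h
    refine h.congr' ?_
    filter_upwards [eventually_gt_atTop 0] with s hs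
    have hw : 0 < π ^ 2 / s := by positivity
    have h2 := hc _ (modParam_pos hw) (modParam_lt_one hw)
    rw [latticeParam_modParam hw, modParam_dual hs, bwHyp, sub_sub_cancel] at h2
    linarith
  have hhalf := hlim.comp (tendsto_id.atTop_div_const (two_pos (α := ℝ)))
  have hQ : Tendsto (fun s : ℝ => 2 * bwSum (2 * (π ^ 2 / s)) - bwSum (π ^ 2 / s)) atTop
      (𝓝 (2 * -c - -c)) := by
    refine ((hhalf.const_mul 2).sub hlim).congr fun s => ?_
    simp only [Function.comp_apply, id_eq]
    rw [show π ^ 2 / (s / 2) = 2 * (π ^ 2 / s) by ring]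
    ring
  have := tendsto_nhds_unique hQ tendsto_two_mul_bwSum_sub
  have := hc t h0 h1
  linarith

end

theorem stmt12 (t : ℝ) (ht0 : 0 < t) (ht1 : t < 1) (q : ℝ)
    (hq : q = Real.exp (-2 * π * hyp2F1 (1/2) (1/2) 1 (1 - t) / hyp2F1 (1/2) (1/2) 1 t)) :
    -(π / 8) * (Real.log ((1 - t) / 16)
        + ((1 - t) / 4) * hyp4F3 (3/2) (3/2) 1 1 2 2 2 (1 - t))
      = ellipticDilog q Complex.I
        + ellipticDilog q (Complex.I * (Real.sqrt q : ℂ)) := by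
  have hq' : q = Real.exp (-(2 * latticeParam t)) := by
    rw [hq, hyp2F1_half, hyp2F1_half, latticeParam]
    congr 1
    ring
  rw [hq', ellipticDilog_add_eq_bwSum (latticeParam_pos ht0 ht1), ← bwHyp_eq_bwSum ht0 ht1,
    bwHyp, mul_hyp4F3_eq_ellL (by rw [abs_lt]; constructor <;> linarith)]
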